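/- arXiv:1706.01578 — 2 statements merged into one kernel-verified Lean document; each statement's English description precedes it below -/
import Mathlib

section
/- Dual representation for generalized Bessel meanders of dimensions (δ, 3−δ): Let δ ∈ (0,3) and let ν be the Beta(δ/2, (3−δ)/2) distribution. Let d ≥ 1, 0 = s₀ < s₁ < … < s_d, and 0 ≤ t₁ < t₂ < … < t_d < 1 with t₀ = 0 and t_{d+1} = 1. Then ∫_0^1 [ ∫_{(0,∞)^d} exp(−∑_{k=1}^d ((s_{d+1−k} − s_{d−k})/√v) · u_k) · f_{v(1−t_d),…,v(1−t₁)}(u₁,…,u_d) du₁…du_d ] · (v^{δ/2−1}(1−v)^{(1−δ)/2}/B(δ/2,(3−δ)/2)) dv = (1/(2^{δ/2} Γ(δ/2))) · ∫_{(0,∞)^{d+1}} x₀^{δ/2−1} · exp(−(1/2) ∑_{k=0}^d (t_{k+1} − t_k) x_k) · ∏_{k=1}^d p_{s_k − s_{k−1}}(x_{k−1}, x_k) dx₀ dx₁ … dx_d, where B(α,β) = Γ(α)Γ(β)/Γ(α+β). (The left-hand side is the Laplace transform E[exp(−∑_{k=1}^d (s_k − s_{k−1}) B^{(δ,3−δ)}_{1−t_k})]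 of the generalized Bessel meander of dimensions (δ, 3−δ).) -/
open MeasureTheory Real Finset

/-- Transition density `p_t(x,y)` of the auxiliary Markov process `X`. -/
noncomputable def transP (t x y : ℝ) : ℝ :=
  2 * t * Real.sqrt y / (Real.pi * ((y - x) ^ 2 + 2 * (x + y) * t ^ 2 + t ^ 4))

/-- The function `ℓ_t(y)`. -/
noncomputable def ellF (t y : ℝ) : ℝ :=
  if 0 < y then y * Real.exp (-(y ^ 2) / (2 * t)) / Real.sqrt (2 * Real.pi * t ^ 3) else 0

/-- The function `g_t(y₁,y₂)`. -/
noncomputable def gF (t y₁ y₂ : ℝ) : ℝ :=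
  if 0 < y₁ ∧ 0 < y₂ then
    (1 / Real.sqrt (2 * Real.pi * t)) *
      (Real.exp (-((y₁ - y₂) ^ 2) / (2 * t)) - Real.exp (-((y₁ + y₂) ^ 2) / (2 * t)))
  else 0

/-- The joint density `f_{t₁,…,t_{n+1}}(y₁,…,y_{n+1})` of the Brownian excursion
at `n+1` time points (indexed by `Fin (n+1)`). -/
noncomputable def excDensity (n : ℕ) (t y : Fin (n + 1) → ℝ) : ℝ :=
  Real.sqrt (8 * Real.pi) * ellF (t 0) (y 0) * ellF (1 - t (Fin.last n)) (y (Fin.last n)) *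
    ∏ k : Fin n, gF (t k.succ - t k.castSucc) (y k.castSucc) (y k.succ)


lemma aux_exp_cos_int {c : ℝ} (hc : 0 < c) (b : ℝ) :
    IntegrableOn (fun w => Real.exp (-c * w) * Real.cos (b * w)) (Set.Ioi 0) := by
  refine (exp_neg_integrableOn_Ioi 0 hc).mono' (by fun_prop) ?_
  refine Filter.Eventually.of_forall fun w => ?_
  rw [norm_mul, Real.norm_of_nonneg (Real.exp_nonneg _)]
  exact mul_le_of_le_one_right (Real.exp_nonneg _) (Real.abs_cos_le_one _)

lemma aux_exp_cos {c : ℝ} (hc : 0 < c) (b : ℝ) :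
    ∫ w in Set.Ioi (0:ℝ), Real.exp (-c * w) * Real.cos (b * w) = c / (c ^ 2 + b ^ 2) := by
  have ha : ((-c : ℝ) + (b : ℝ) * Complex.I : ℂ).re < 0 := by simp [hc]
  have h := integral_exp_mul_complex_Ioi ha 0
  have hi := integrableOn_exp_mul_complex_Ioi ha 0
  have h2 := congrArg Complex.re h
  have h3 := integral_re (𝕜 := ℂ) hi
  simp only [RCLike.re_eq_complex_re] at h3
  rw [← h3] at h2
  have e : ∀ w : ℝ, (Complex.exp (((-c : ℝ) + (b : ℝ) * Complex.I : ℂ) * w)).re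
      = Real.exp (-c * w) * Real.cos (b * w) := by
    intro w
    rw [Complex.exp_re]; simp
  simp only [e] at h2
  rw [h2]
  simp [Complex.div_re, Complex.normSq]
  field_simp

lemma aux_exp_sin_sin {c : ℝ} (hc : 0 < c) {x y : ℝ} (hx : 0 < x) (hy : 0 < y) :
    ∫ w in Set.Ioi (0:ℝ), Real.exp (-c * w) * (Real.sin (√x * w) * Real.sin (√y * w))
      = π * √x * transP c x y := by
  have e : ∀ w : ℝ, Real.exp (-c * w) * (Real.sin (√x * w) * Real.sin (√y * w)) =
      (1/2) * (Real.exp (-c * w) * Real.cos ((√x - √y) * w)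
        - Real.exp (-c * w) * Real.cos ((√x + √y) * w)) := by
    intro w
    rw [sub_mul, add_mul, Real.cos_sub, Real.cos_add]; ring
  simp only [e]
  rw [integral_const_mul, integral_sub (aux_exp_cos_int hc _) (aux_exp_cos_int hc _),
    aux_exp_cos hc, aux_exp_cos hc, transP]
  obtain ⟨a, ha, rfl⟩ : ∃ a, 0 < a ∧ a ^ 2 = x := ⟨√x, Real.sqrt_pos.2 hx, Real.sq_sqrt hx.le⟩
  obtain ⟨b, hb, rfl⟩ : ∃ b, 0 < b ∧ b ^ 2 = y := ⟨√y, Real.sqrt_pos.2 hy, Real.sq_sqrt hy.le⟩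
  rw [Real.sqrt_sq ha.le, Real.sqrt_sq hb.le]
  have h1 : c ^ 2 + (a - b) ^ 2 ≠ 0 := by positivity
  have h2 : c ^ 2 + (a + b) ^ 2 ≠ 0 := by positivity
  have h3 : (b ^ 2 - a ^ 2) ^ 2 + 2 * (a ^ 2 + b ^ 2) * c ^ 2 + c ^ 4 =
    (c ^ 2 + (a - b) ^ 2) * (c ^ 2 + (a + b) ^ 2) := by ring
  rw [h3]
  field_simp
  ring

lemma aux_gauss_cos_int {T : ℝ} (hT : 0 < T) (w : ℝ) :
    Integrable (fun ξ => Real.exp (-(T/2) * ξ ^ 2) * Real.cos (ξ * w)) := by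
  refine (integrable_exp_neg_mul_sq (b := T/2) (by positivity)).mono' (by fun_prop) ?_
  refine Filter.Eventually.of_forall fun w => ?_
  rw [norm_mul, Real.norm_of_nonneg (Real.exp_nonneg _)]
  exact mul_le_of_le_one_right (Real.exp_nonneg _) (Real.abs_cos_le_one _)

lemma aux_gauss_cos {T : ℝ} (hT : 0 < T) (w : ℝ) :
    ∫ ξ in Set.Ioi (0:ℝ), Real.exp (-(T/2) * ξ ^ 2) * Real.cos (ξ * w)
      = (1/2) * √(2 * π / T) * Real.exp (-(w ^ 2) / (2 * T)) := by
  have h := fourierIntegral_gaussian (b := ((T/2 : ℝ) : ℂ)) (by simpa using hT) (w : ℂ)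
  have e : ∀ ξ : ℝ, Complex.exp (Complex.I * w * ξ) * Complex.exp (-((T/2 : ℝ) : ℂ) * ξ ^ 2)
      = Complex.exp (((-(T/2) * ξ ^ 2 : ℝ) : ℂ) + ((ξ * w : ℝ) : ℂ) * Complex.I) := by
    intro ξ
    rw [← Complex.exp_add]; congr 1; push_cast; ring
  have hi : Integrable (fun ξ : ℝ => Complex.exp (Complex.I * w * ξ) *
      Complex.exp (-((T/2 : ℝ) : ℂ) * ξ ^ 2)) := by
    refine (integrable_exp_neg_mul_sq (b := T/2) (by positivity)).mono' (by fun_prop) ?_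
    refine Filter.Eventually.of_forall fun w => ?_
    rw [e, Complex.norm_exp]
    simp [-Complex.ofReal_pow]
  have h2 := congrArg Complex.re h
  have h3 := integral_re (𝕜 := ℂ) hi
  simp only [RCLike.re_eq_complex_re] at h3
  rw [← h3] at h2
  have e2 : ∀ ξ : ℝ, (Complex.exp (Complex.I * w * ξ) *
      Complex.exp (-((T/2 : ℝ) : ℂ) * ξ ^ 2)).re
      = Real.exp (-(T/2) * |ξ| ^ 2) * Real.cos (|ξ| * w) := by
    intro w'
    rw [e, Complex.exp_re]
    have : Real.cos (|w'| * w) = Real.cos (w' * w) := by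
      rcases abs_choice w' with h | h <;> rw [h] ; rw [neg_mul, Real.cos_neg]
    rw [this, sq_abs]
    simp [-Complex.ofReal_pow]
  have e3 : ((π : ℂ) / ((T/2 : ℝ) : ℂ)) ^ (1/2 : ℂ) * Complex.exp (-(w:ℂ) ^ 2 / (4 * ((T/2 : ℝ) : ℂ)))
     = ((√(2 * π / T) * Real.exp (-(w ^ 2) / (2 * T)) : ℝ) : ℂ) := by
    rw [Real.sqrt_eq_rpow]
    push_cast
    rw [Complex.ofReal_cpow (by positivity)]
    congr 2
    · push_cast; field_simp
    · push_cast; norm_num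
    · congr 1; field_simp; norm_num; ring
  rw [e3, Complex.ofReal_re] at h2
  simp only [e2] at h2
  rw [integral_comp_abs (f := fun ξ => Real.exp (-(T/2) * ξ ^ 2) * Real.cos (ξ * w))] at h2
  linarith

lemma aux_sqrt_subst (g : ℝ → ℝ) :
    ∫ x in Set.Ioi (0:ℝ), g x = ∫ ξ in Set.Ioi (0:ℝ), 2 * ξ * g (ξ ^ 2) := by
  rw [← integral_comp_rpow_Ioi_of_pos (g := g) (p := 2) two_pos]
  refine setIntegral_congr_fun measurableSet_Ioi fun x hx => ?_
  norm_num

lemma aux_mid {T : ℝ} (hT : 0 < T) {w w' : ℝ} (hw : 0 < w) (hw' : 0 < w') :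
    ∫ x in Set.Ioi (0:ℝ), Real.exp (-(T/2) * x) / √x * (Real.sin (√x * w) * Real.sin (√x * w'))
      = π * gF T w w' := by
  rw [aux_sqrt_subst]
  have : ∀ ξ ∈ Set.Ioi (0:ℝ), 2 * ξ * (Real.exp (-(T/2) * ξ ^ 2) / √(ξ ^ 2) *
      (Real.sin (√(ξ ^ 2) * w) * Real.sin (√(ξ ^ 2) * w'))) =
      Real.exp (-(T/2) * ξ ^ 2) * Real.cos (ξ * (w - w')) -
      Real.exp (-(T/2) * ξ ^ 2) * Real.cos (ξ * (w + w')) := by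
    intro ξ hξ
    have hξ : 0 < ξ := hξ
    rw [Real.sqrt_sq hξ.le, mul_sub, mul_add, Real.cos_sub, Real.cos_add]
    field_simp
    ring
  rw [setIntegral_congr_fun measurableSet_Ioi this,
    integral_sub (aux_gauss_cos_int hT _).integrableOn (aux_gauss_cos_int hT _).integrableOn,
    aux_gauss_cos hT, aux_gauss_cos hT, gF, if_pos ⟨hw, hw'⟩]
  have : (1/2) * √(2 * π / T) = π * (1 / √(2 * π * T)) := by
    rw [Real.sqrt_div (by positivity), Real.sqrt_mul (by positivity) T]
    have := Real.sq_sqrt (show 0 ≤ 2 * π by positivity)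
    have : √(2 * π) ≠ 0 := by positivity
    field_simp
    linarith
  linear_combination (Real.exp (-((w - w') ^ 2) / (2 * T)) - Real.exp (-((w + w') ^ 2) / (2 * T))) * this

lemma aux_end {T : ℝ} (hT : 0 < T) {w : ℝ} (hw : 0 < w) :
    ∫ x in Set.Ioi (0:ℝ), Real.exp (-(T/2) * x) * Real.sin (√x * w)
      = 2 * π * ellF T w := by
  rw [aux_sqrt_subst]
  have : ∀ ξ ∈ Set.Ioi (0:ℝ), 2 * ξ * (Real.exp (-(T/2) * ξ ^ 2) * Real.sin (√(ξ ^ 2) * w)) =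
      2 * ξ * (Real.exp (-(T/2) * ξ ^ 2) * Real.sin (ξ * w)) := by
    intro ξ hξ
    have hξ : 0 < ξ := hξ
    rw [Real.sqrt_sq hξ.le]
  rw [setIntegral_congr_fun measurableSet_Ioi this]
  have hi : IntegrableOn (fun ξ => 2 * ξ * (Real.exp (-(T/2) * ξ ^ 2) * Real.sin (ξ * w)))
      (Set.Ioi 0) := by
    refine Integrable.integrableOn ?_
    refine ((integrable_mul_exp_neg_mul_sq (b := T/2) (by positivity)).const_mul 2).norm.mono'
      (by fun_prop) ?_
    refine Filter.Eventually.of_forall fun ξ => ?_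
    rw [← mul_assoc, mul_assoc 2, norm_mul]
    exact mul_le_of_le_one_right (norm_nonneg _) (Real.abs_sin_le_one _)
  have hd : ∀ ξ ∈ Set.Ici (0:ℝ), HasDerivAt
     (fun ξ => -(2/T) * (Real.exp (-(T/2) * ξ ^ 2) * Real.sin (ξ * w)))
     (2 * ξ * (Real.exp (-(T/2) * ξ ^ 2) * Real.sin (ξ * w)) - (2 * w / T) *
       (Real.exp (-(T/2) * ξ ^ 2) * Real.cos (ξ * w))) ξ := by
    intro ξ _
    have h1 : HasDerivAt (fun ξ : ℝ => Real.exp (-(T/2) * ξ ^ 2))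
        (Real.exp (-(T/2) * ξ ^ 2) * (-(T/2) * (2 * ξ))) ξ := by
      have := ((hasDerivAt_pow 2 ξ).const_mul (-(T/2))).exp
      simpa using this
    have h2 : HasDerivAt (fun ξ : ℝ => Real.sin (ξ * w)) (Real.cos (ξ * w) * w) ξ := by
      simpa using ((hasDerivAt_id ξ).mul_const w).sin
    refine ((h1.mul h2).const_mul (-(2/T))).congr_deriv ?_
    field_simp
    ring
  have ht : Filter.Tendsto (fun ξ => -(2/T) * (Real.exp (-(T/2) * ξ ^ 2) * Real.sin (ξ * w)))
     Filter.atTop (nhds 0) := by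
    rw [← mul_zero (-(2/T))]
    refine Filter.Tendsto.const_mul _ ?_
    have : Filter.Tendsto (fun ξ:ℝ => Real.exp (-(T/2) * ξ ^ 2)) Filter.atTop (nhds 0) := by
      refine Real.tendsto_exp_atBot.comp ?_
      exact (Filter.tendsto_pow_atTop two_ne_zero).const_mul_atTop_of_neg (by linarith)
    refine squeeze_zero_norm (fun ξ => ?_) this
    rw [norm_mul, Real.norm_of_nonneg (Real.exp_nonneg _)]
    exact mul_le_of_le_one_right (Real.exp_nonneg _) (Real.abs_sin_le_one _)
  have hc := ((aux_gauss_cos_int hT w).integrableOn (s := Set.Ioi 0)).const_mul (2 * w / T)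
  have := integral_Ioi_of_hasDerivAt_of_tendsto' hd (hi.sub hc) ht
  rw [integral_sub hi hc, integral_const_mul, aux_gauss_cos hT] at this
  simp only [zero_mul, Real.sin_zero, mul_zero, sub_zero] at this
  rw [sub_eq_zero.1 this, ellF, if_pos hw]
  have : √(2 * π / T) * √(2 * π * T ^ 3) = 2 * π * T := by
    rw [← Real.sqrt_mul (by positivity), show 2 * π / T * (2 * π * T ^ 3) = (2 * π * T) ^ 2 by
      field_simp, Real.sqrt_sq (by positivity)]
  have h0 : √(2 * π * T ^ 3) ≠ 0 := by positivity
  rw [show 2 * π * (w * Real.exp (-w ^ 2 / (2 * T)) / √(2 * π * T ^ 3)) =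
    (√(2 * π / T) * √(2 * π * T ^ 3)) / T * (w * Real.exp (-w ^ 2 / (2 * T)) / √(2 * π * T ^ 3)) by
      rw [this]; field_simp]
  field_simp

noncomputable def wtAux (n : ℕ) (j : Fin (n + 2)) (x : ℝ) : ℝ :=
  if j = 0 ∨ j = Fin.last (n + 1) then 1 else (√x)⁻¹

lemma wtAux_zero (n : ℕ) (x : ℝ) : wtAux n 0 x = 1 := by simp [wtAux]
lemma wtAux_last (n : ℕ) (x : ℝ) : wtAux n (Fin.last (n + 1)) x = 1 := by simp [wtAux]
lemma wtAux_mid (n : ℕ) (k : Fin n) (x : ℝ) : wtAux n k.castSucc.succ x = (√x)⁻¹ := by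
  rw [wtAux, if_neg]
  rintro (h | h)
  · exact Fin.succ_ne_zero _ h
  · rw [Fin.succ_castSucc] at h
    exact Fin.castSucc_ne_last _ h
lemma wtAux_nonneg (n : ℕ) (j : Fin (n + 2)) (x : ℝ) : 0 ≤ wtAux n j x := by
  rw [wtAux]; split_ifs <;> positivity

lemma prod3Aux {n : ℕ} (f : Fin (n + 2) → ℝ) :
    ∏ j, f j = f 0 * f (Fin.last (n + 1)) * ∏ k : Fin n, f k.castSucc.succ := by
  rw [Fin.prod_univ_succ, Fin.prod_univ_castSucc, Fin.succ_last]; ring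

noncomputable def sinAux {n : ℕ} (w : Fin (n + 1) → ℝ) (j : Fin (n + 2)) (x : ℝ) : ℝ :=
  (Fin.cons 1 (fun k => Real.sin (√x * w k)) : Fin (n + 2) → ℝ) j *
  (Fin.snoc (fun k => Real.sin (√x * w k)) 1 : Fin (n + 2) → ℝ) j

lemma sinAux_zero {n : ℕ} (w : Fin (n + 1) → ℝ) (x : ℝ) :
    sinAux w 0 x = Real.sin (√x * w 0) := by
  have : (0 : Fin (n + 2)) = Fin.castSucc (0 : Fin (n + 1)) := rfl
  rw [sinAux, Fin.cons_zero, this, Fin.snoc_castSucc (α := fun _ => ℝ), one_mul]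
lemma sinAux_last {n : ℕ} (w : Fin (n + 1) → ℝ) (x : ℝ) :
    sinAux w (Fin.last (n + 1)) x = Real.sin (√x * w (Fin.last n)) := by
  rw [sinAux, Fin.snoc_last, ← Fin.succ_last, Fin.cons_succ, mul_one]
lemma sinAux_mid {n : ℕ} (w : Fin (n + 1) → ℝ) (k : Fin n) (x : ℝ) :
    sinAux w k.castSucc.succ x =
      Real.sin (√x * w k.castSucc) * Real.sin (√x * w k.succ) := by
  rw [sinAux, Fin.cons_succ, Fin.succ_castSucc, Fin.snoc_castSucc (α := fun _ => ℝ)]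
lemma sinAux_prod {n : ℕ} (w : Fin (n + 1) → ℝ) (x : Fin (n + 2) → ℝ) :
    ∏ j, sinAux w j (x j) =
      ∏ k : Fin (n + 1), (Real.sin (√(x k.castSucc) * w k) * Real.sin (√(x k.succ) * w k)) := by
  simp only [sinAux]
  rw [Finset.prod_mul_distrib, Finset.prod_mul_distrib, Fin.prod_univ_succ, mul_comm]
  congr 1
  · rw [Fin.prod_univ_castSucc]
    simp
  · simp

noncomputable def coreF (n : ℕ) (T : Fin (n + 2) → ℝ) (c : Fin (n + 1) → ℝ)
    (x : Fin (n + 2) → ℝ) (w : Fin (n + 1) → ℝ) : ℝ :=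
  (∏ j, Real.exp (-(T j / 2) * x j) * wtAux n j (x j)) *
    ∏ k : Fin (n + 1), (Real.exp (-c k * w k) *
      (Real.sin (√(x k.castSucc) * w k) * Real.sin (√(x k.succ) * w k)))

lemma aux_wt_int {n : ℕ} (j : Fin (n + 2)) {T : ℝ} (hT : 0 < T) :
    Integrable (fun x => Real.exp (-(T / 2) * x) * wtAux n j x)
      (volume.restrict (Set.Ioi 0)) := by
  by_cases h : j = 0 ∨ j = Fin.last (n + 1)
  · simp only [wtAux, if_pos h, mul_one]
    exact exp_neg_integrableOn_Ioi 0 (by positivity)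
  · simp only [wtAux, if_neg h]
    have := integrableOn_rpow_mul_exp_neg_mul_rpow (p := 1) (s := -(1/2)) (b := T / 2)
      (by norm_num) one_pos (by positivity)
    refine IntegrableOn.congr_fun this (fun x hx => ?_) measurableSet_Ioi
    have hx : 0 < x := hx
    simp only [Real.rpow_one]
    rw [Real.rpow_neg hx.le, Real.sqrt_eq_rpow]
    ring

lemma wtAux_meas (n : ℕ) (j : Fin (n + 2)) : Measurable (wtAux n j) := by
  unfold wtAux
  split_ifs <;> fun_prop

lemma coreF_int (n : ℕ) (T : Fin (n + 2) → ℝ) (c : Fin (n + 1) → ℝ)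
    (hT : ∀ j, 0 < T j) (hc : ∀ k, 0 < c k) :
    Integrable (Function.uncurry (coreF n T c))
      ((Measure.pi fun _ : Fin (n + 2) => (volume : Measure ℝ).restrict (Set.Ioi 0)).prod
      (Measure.pi fun _ : Fin (n + 1) => (volume : Measure ℝ).restrict (Set.Ioi 0))) := by
  have h1 := Integrable.fintype_prod
    (μ := fun _ : Fin (n + 2) => (volume : Measure ℝ).restrict (Set.Ioi 0))
    (f := fun j x => Real.exp (-(T j / 2) * x) * wtAux n j x)
    (fun j => aux_wt_int j (hT j))
  have h2 := Integrable.fintype_prod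
    (μ := fun _ : Fin (n + 1) => (volume : Measure ℝ).restrict (Set.Ioi 0))
    (f := fun k w => Real.exp (-c k * w))
    (fun k => exp_neg_integrableOn_Ioi 0 (hc k))
  refine (h1.mul_prod h2).mono' ?_ ?_
  · have hw := wtAux_meas n
    apply Measurable.aestronglyMeasurable
    unfold coreF Function.uncurry
    fun_prop
  · refine Filter.Eventually.of_forall fun p => ?_
    have hn : 0 ≤ ∏ j, Real.exp (-(T j / 2) * p.1 j) * wtAux n j (p.1 j) :=
      Finset.prod_nonneg fun j _ => mul_nonneg (Real.exp_nonneg _) (wtAux_nonneg _ _ _)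
    simp only [Function.uncurry, coreF]
    rw [norm_mul, Real.norm_of_nonneg hn]
    refine mul_le_mul_of_nonneg_left ?_ hn
    rw [norm_prod]
    refine Finset.prod_le_prod (fun _ _ => norm_nonneg _) fun k _ => ?_
    rw [norm_mul, Real.norm_of_nonneg (Real.exp_nonneg _), norm_mul]
    refine mul_le_of_le_one_right (Real.exp_nonneg _) ?_
    exact mul_le_one₀ (Real.abs_sin_le_one _) (norm_nonneg _) (Real.abs_sin_le_one _)

lemma coreF_int_w (n : ℕ) (T : Fin (n + 2) → ℝ) (c : Fin (n + 1) → ℝ)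
    (hc : ∀ k, 0 < c k) (x : Fin (n + 2) → ℝ) (hx : ∀ j, 0 < x j) :
    ∫ w, coreF n T c x w ∂(Measure.pi fun _ : Fin (n + 1) =>
      (volume : Measure ℝ).restrict (Set.Ioi 0)) =
    π ^ (n + 1) * (√(x 0) * Real.exp (-(1/2:ℝ) * ∑ k, T k * x k) *
      ∏ k : Fin (n + 1), transP (c k) (x k.castSucc) (x k.succ)) := by
  unfold coreF
  rw [integral_const_mul, integral_fintype_prod_eq_prod
    (f := fun k w => Real.exp (-c k * w) *
      (Real.sin (√(x (Fin.castSucc k)) * w) * Real.sin (√(x (Fin.succ k)) * w)))]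
  simp only [aux_exp_sin_sin (hc _) (hx _) (hx _)]
  rw [Finset.prod_mul_distrib, Finset.prod_mul_distrib, Finset.prod_mul_distrib,
    Finset.prod_const, Finset.card_univ, Fintype.card_fin, ← Real.exp_sum,
    prod3Aux (fun j => wtAux n j (x j)), Fin.prod_univ_succ (fun k => √(x (Fin.castSucc k)))]
  simp only [wtAux_zero, wtAux_last, wtAux_mid]
  have h1 : (∏ k : Fin n, (√(x k.castSucc.succ))⁻¹) * ∏ k : Fin n, √(x k.succ.castSucc) = 1 := by
    rw [← Finset.prod_mul_distrib]
    refine Finset.prod_eq_one fun k _ => ?_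
    rw [Fin.succ_castSucc]
    exact inv_mul_cancel₀ (Real.sqrt_pos.2 (hx _)).ne'
  have h2 : ∑ j, -(T j / 2) * x j = -(1/2:ℝ) * ∑ k, T k * x k := by
    rw [Finset.mul_sum]; exact Finset.sum_congr rfl fun _ _ => by ring
  rw [h2, Fin.castSucc_zero]
  linear_combination (π ^ (n + 1) * (√(x 0) * Real.exp (-(1/2:ℝ) * ∑ k, T k * x k) *
      ∏ k : Fin (n + 1), transP (c k) (x k.castSucc) (x k.succ))) * h1

lemma coreF_int_x (n : ℕ) (T : Fin (n + 2) → ℝ) (c : Fin (n + 1) → ℝ)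
    (hT : ∀ k, 0 < T k) (w : Fin (n + 1) → ℝ) (hw : ∀ j, 0 < w j) :
    ∫ x, coreF n T c x w ∂(Measure.pi fun _ : Fin (n + 2) =>
      (volume : Measure ℝ).restrict (Set.Ioi 0)) =
    π ^ (n + 1) * (4 * π * (Real.exp (-∑ k, c k * w k) * (ellF (T 0) (w 0) *
      ellF (T (Fin.last (n + 1))) (w (Fin.last n)) *
      ∏ k : Fin n, gF (T k.castSucc.succ) (w k.castSucc) (w k.succ)))) := by
  have e : ∀ x, coreF n T c x w = Real.exp (-∑ k, c k * w k) *
      ∏ j, (Real.exp (-(T j / 2) * x j) * wtAux n j (x j) * sinAux w j (x j)) := by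
    intro x
    rw [coreF, Finset.prod_mul_distrib (f := fun k => Real.exp (-c k * w k)),
      Finset.prod_mul_distrib (g := fun j => sinAux w j (x j)), sinAux_prod,
      ← Real.exp_sum, ← Finset.sum_neg_distrib]
    simp only [neg_mul]
    ring
  simp only [e]
  rw [integral_const_mul, integral_fintype_prod_eq_prod
    (f := fun j x => Real.exp (-(T j / 2) * x) * wtAux n j x * sinAux w j x),
    prod3Aux]
  simp only [wtAux_zero, wtAux_last, wtAux_mid, sinAux_zero, sinAux_last, sinAux_mid, mul_one,
    ← div_eq_mul_inv, aux_end (hT _) (hw _), aux_mid (hT _) (hw _) (hw _)]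
  rw [Finset.prod_mul_distrib, Finset.prod_const, Finset.card_univ, Fintype.card_fin]
  ring

lemma pi_restrict_eq (n : ℕ) : (volume : Measure (Fin n → ℝ)).restrict
    (Set.univ.pi fun _ => Set.Ioi (0 : ℝ)) =
    Measure.pi fun _ : Fin n => (volume : Measure ℝ).restrict (Set.Ioi 0) := by
  rw [volume_pi, Measure.restrict_pi_pi]

lemma ae_pos (n : ℕ) : ∀ᵐ x ∂(Measure.pi fun _ : Fin n =>
    (volume : Measure ℝ).restrict (Set.Ioi 0)), ∀ j, 0 < x j := by
  rw [← pi_restrict_eq]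
  refine (ae_restrict_mem (MeasurableSet.univ_pi fun _ => measurableSet_Ioi)).mono ?_
  intro x hx j
  exact hx j (Set.mem_univ j)

lemma core_integrable (n : ℕ) (T : Fin (n + 2) → ℝ) (c : Fin (n + 1) → ℝ)
    (hT : ∀ j, 0 < T j) (hc : ∀ k, 0 < c k) :
    Integrable (fun x => √(x 0) * Real.exp (-(1/2:ℝ) * ∑ k, T k * x k) *
      ∏ k : Fin (n + 1), transP (c k) (x k.castSucc) (x k.succ))
      (Measure.pi fun _ : Fin (n + 2) => (volume : Measure ℝ).restrict (Set.Ioi 0)) := by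
  have h := (coreF_int n T c hT hc).integral_prod_left.const_mul ((π ^ (n + 1))⁻¹)
  refine h.congr ?_
  filter_upwards [ae_pos (n + 2)] with x hx
  simp only [Function.uncurry]
  rw [coreF_int_w n T c hc x hx, inv_mul_cancel_left₀ (by positivity)]

lemma core_eq (n : ℕ) (T : Fin (n + 2) → ℝ) (c : Fin (n + 1) → ℝ)
    (hT : ∀ j, 0 < T j) (hc : ∀ k, 0 < c k) :
    ∫ x, √(x 0) * Real.exp (-(1/2:ℝ) * ∑ k, T k * x k) *
      ∏ k : Fin (n + 1), transP (c k) (x k.castSucc) (x k.succ)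
      ∂(Measure.pi fun _ : Fin (n + 2) => (volume : Measure ℝ).restrict (Set.Ioi 0)) =
    4 * π * ∫ w, Real.exp (-∑ k, c k * w k) * (ellF (T 0) (w 0) *
      ellF (T (Fin.last (n + 1))) (w (Fin.last n)) *
      ∏ k : Fin n, gF (T k.castSucc.succ) (w k.castSucc) (w k.succ))
      ∂(Measure.pi fun _ : Fin (n + 1) => (volume : Measure ℝ).restrict (Set.Ioi 0)) := by
  have h := integral_integral_swap (coreF_int n T c hT hc)
  rw [integral_congr_ae ((ae_pos (n + 2)).mono fun x hx => coreF_int_w n T c hc x hx),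
    integral_congr_ae ((ae_pos (n + 1)).mono fun w hw => coreF_int_x n T c hT w hw),
    integral_const_mul, integral_const_mul, integral_const_mul] at h
  exact mul_left_cancel₀ (by positivity) h

lemma swap_nonneg_aux {α β : Type*} [MeasurableSpace α] [MeasurableSpace β]
    (μ : Measure α) (ν : Measure β) [SFinite μ] [SFinite ν] (f : α → β → ℝ)
    (hm : AEStronglyMeasurable (Function.uncurry f) (μ.prod ν))
    (hn : ∀ᵐ a ∂μ, ∀ᵐ b ∂ν, 0 ≤ f a b) (hn' : ∀ᵐ b ∂ν, ∀ᵐ a ∂μ, 0 ≤ f a b)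
    (h1 : ∀ᵐ a ∂μ, Integrable (f a) ν) (h2 : ∀ᵐ b ∂ν, Integrable (fun a => f a b) μ) :
    ∫ a, ∫ b, f a b ∂ν ∂μ = ∫ b, ∫ a, f a b ∂μ ∂ν := by
  rw [integral_eq_lintegral_of_nonneg_ae (hn.mono fun a ha => integral_nonneg_of_ae ha)
      hm.integral_prod_right',
    integral_eq_lintegral_of_nonneg_ae (hn'.mono fun a ha => integral_nonneg_of_ae ha)
      (hm.prod_swap.integral_prod_right' (f := fun z : β × α => f z.2 z.1))]
  congr 1
  have e1 : ∫⁻ a, ENNReal.ofReal (∫ b, f a b ∂ν) ∂μ = ∫⁻ a, ∫⁻ b, ENNReal.ofReal (f a b) ∂ν ∂μ := by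
    refine lintegral_congr_ae ?_
    filter_upwards [hn, h1] with a ha ha'
    exact ofReal_integral_eq_lintegral_ofReal ha' ha
  have e2 : ∫⁻ b, ENNReal.ofReal (∫ a, f a b ∂μ) ∂ν = ∫⁻ b, ∫⁻ a, ENNReal.ofReal (f a b) ∂μ ∂ν := by
    refine lintegral_congr_ae ?_
    filter_upwards [hn', h2] with a ha ha'
    exact ofReal_integral_eq_lintegral_ofReal ha' ha
  rw [e1, e2]
  exact lintegral_lintegral_swap hm.aemeasurable.ennreal_ofReal

lemma ell_scale {v T : ℝ} (hv : 0 < v) (hT : 0 < T) (w : ℝ) :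
    ellF (v * T) (√v * w) = v⁻¹ * ellF T w := by
  have hs : 0 < √v := Real.sqrt_pos.2 hv
  unfold ellF
  by_cases hw : 0 < w
  · rw [if_pos hw, if_pos (by positivity)]
    have h1 : √(2 * π * (v * T) ^ 3) = v * √v * √(2 * π * T ^ 3) := by
      rw [show 2 * π * (v * T) ^ 3 = (v ^ 2 * v) * (2 * π * T ^ 3) by ring,
        Real.sqrt_mul (by positivity), Real.sqrt_mul (by positivity), Real.sqrt_sq hv.le]
    have h2 : -(√v * w) ^ 2 / (2 * (v * T)) = -w ^ 2 / (2 * T) := by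
      rw [mul_pow, Real.sq_sqrt hv.le]; field_simp
    rw [h1, h2]
    have : √(2 * π * T ^ 3) ≠ 0 := by positivity
    field_simp
  · rw [if_neg hw, if_neg (by rwa [mul_pos_iff_of_pos_left hs]), mul_zero]

lemma g_scale {v T : ℝ} (hv : 0 < v) (w w' : ℝ) :
    gF (v * T) (√v * w) (√v * w') = (√v)⁻¹ * gF T w w' := by
  have hs : 0 < √v := Real.sqrt_pos.2 hv
  unfold gF
  simp only [mul_pos_iff_of_pos_left hs]
  split_ifs
  · have h1 : √(2 * π * (v * T)) = √v * √(2 * π * T) := by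
      rw [show 2 * π * (v * T) = v * (2 * π * T) by ring, Real.sqrt_mul hv.le]
    have h2 : ∀ a, -(√v * a) ^ 2 / (2 * (v * T)) = -a ^ 2 / (2 * T) := by
      intro a
      rw [mul_pow, Real.sq_sqrt hv.le, ← mul_neg, mul_left_comm 2 v T,
        mul_div_mul_left _ _ hv.ne']
    rw [h1, ← mul_sub, ← mul_add, h2, h2, one_div, mul_inv, one_div]
    ring
  · rw [mul_zero]

lemma g_symm (T w w' : ℝ) : gF T w w' = gF T w' w := by
  unfold gF
  simp only [and_comm (a := 0 < w), show (w - w') ^ 2 = (w' - w) ^ 2 by ring, add_comm w w']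

lemma rev_integral (n : ℕ) (k : (Fin n → ℝ) → ℝ) :
    ∫ w in Set.univ.pi fun _ => Set.Ioi (0 : ℝ), k (fun i => w i.rev) =
    ∫ w in Set.univ.pi fun _ => Set.Ioi (0 : ℝ), k w := by
  have h := volume_measurePreserving_piCongrLeft (fun _ : Fin n => ℝ) Fin.revPerm
  have e : ∀ w, (MeasurableEquiv.piCongrLeft (fun _ : Fin n => ℝ) Fin.revPerm) w =
      fun i => w i.rev := by
    intro w
    funext i
    have := MeasurableEquiv.piCongrLeft_apply_apply (β := fun _ : Fin n => ℝ) Fin.revPerm w i.rev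
    simpa using this
  have h2 := h.setIntegral_preimage_emb (MeasurableEquiv.measurableEmbedding _) k
    (Set.univ.pi fun _ => Set.Ioi (0 : ℝ))
  rw [← h2]
  have hp : (MeasurableEquiv.piCongrLeft (fun _ : Fin n => ℝ) Fin.revPerm) ⁻¹'
      (Set.univ.pi fun _ => Set.Ioi (0 : ℝ)) = Set.univ.pi fun _ => Set.Ioi (0 : ℝ) := by
    ext w
    simp only [Set.mem_preimage, Set.mem_univ_pi, e, Set.mem_Ioi]
    exact ⟨fun h i => by simpa using h i.rev, fun h i => h _⟩
  rw [hp]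
  simp only [e]

open scoped Pointwise in
lemma smul_orthant (n : ℕ) {R : ℝ} (hR : 0 < R) :
    R • (Set.univ.pi fun _ : Fin n => Set.Ioi (0 : ℝ)) = Set.univ.pi fun _ => Set.Ioi (0 : ℝ) := by
  ext w
  rw [Set.mem_smul_set_iff_inv_smul_mem₀ hR.ne']
  simp only [Set.mem_univ_pi, Set.mem_Ioi, Pi.smul_apply, smul_eq_mul]
  exact forall_congr' fun i => mul_pos_iff_of_pos_left (inv_pos.2 hR)

/-- increments with the first one shifted by `r` -/
noncomputable def TAux {n : ℕ} (t : Fin (n + 3) → ℝ) (r : ℝ) (j : Fin (n + 2)) : ℝ :=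
  t j.succ - t j.castSucc + if j = 0 then r else 0

lemma TAux_pos {n : ℕ} (t : Fin (n + 3) → ℝ)
    (ht0 : t 0 = 0) (htlast : t (Fin.last (n + 2)) = 1)
    (ht1 : 0 ≤ t 1)
    (htmono : StrictMonoOn t (Set.Icc (1 : Fin (n + 3)) (Fin.last (n + 1)).castSucc))
    (htd : t (Fin.last (n + 1)).castSucc < 1) {r : ℝ} (hr : 0 < r) (j : Fin (n + 2)) :
    0 < TAux t r j := by
  unfold TAux
  by_cases hj : j = 0
  · subst hj
    rw [if_pos rfl, Fin.castSucc_zero, ht0, Fin.succ_zero_eq_one]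
    linarith
  · rw [if_neg hj, add_zero, sub_pos]
    by_cases hl : j = Fin.last (n + 1)
    · subst hl
      rw [Fin.succ_last, htlast]
      exact htd
    · have h1 : (j : ℕ) ≠ 0 := fun h => hj (Fin.ext h)
      have h2 : (j : ℕ) ≠ n + 1 := fun h => hl (Fin.ext h)
      have h3 := j.isLt
      apply htmono
      · constructor <;> rw [Fin.le_def] <;> simp <;> omega
      · constructor <;> rw [Fin.le_def] <;> simp <;> omega
      · exact Fin.castSucc_lt_succ

lemma inner_eq {n : ℕ} (t : Fin (n + 3) → ℝ) (c : Fin (n + 1) → ℝ)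
    (ht0 : t 0 = 0) (htlast : t (Fin.last (n + 2)) = 1) {r v : ℝ} (hv : 0 < v)
    (hvr : v * (1 + r) = 1) (hT : ∀ j, 0 < TAux t r j) :
    (∫ u : Fin (n + 1) → ℝ in Set.univ.pi fun _ => Set.Ioi (0 : ℝ),
          Real.exp (-(∑ k : Fin (n + 1), (c k.rev / Real.sqrt v) * u k)) *
            excDensity n (fun i => v * (1 - t i.rev.succ.castSucc)) u) =
    √(8 * π) * (√v * (v ^ 2)⁻¹) * ∫ w, Real.exp (-∑ k, c k * w k) * (ellF (TAux t r 0) (w 0) *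
      ellF (TAux t r (Fin.last (n + 1))) (w (Fin.last n)) *
      ∏ k : Fin n, gF (TAux t r k.castSucc.succ) (w k.castSucc) (w k.succ))
      ∂(Measure.pi fun _ : Fin (n + 1) => (volume : Measure ℝ).restrict (Set.Ioi 0)) := by
  have hs : 0 < √v := Real.sqrt_pos.2 hv
  rw [← pi_restrict_eq]
  have h := Measure.setIntegral_comp_smul_of_pos (volume : Measure (Fin (n + 1) → ℝ))
    (fun u => Real.exp (-(∑ k : Fin (n + 1), (c k.rev / Real.sqrt v) * u k)) *
            excDensity n (fun i => v * (1 - t i.rev.succ.castSucc)) u)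
    (Set.univ.pi fun _ => Set.Ioi (0 : ℝ)) hs
  rw [smul_orthant (n + 1) hs, Module.finrank_fin_fun, smul_eq_mul] at h
  rw [← mul_inv_cancel_left₀ (pow_pos hs (n + 1)).ne' (∫ u in _, _), ← h]
  rw [← rev_integral (n + 1) (fun w => Real.exp (-∑ k, c k * w k) * (ellF (TAux t r 0) (w 0) *
      ellF (TAux t r (Fin.last (n + 1))) (w (Fin.last n)) *
      ∏ k : Fin n, gF (TAux t r k.castSucc.succ) (w k.castSucc) (w k.succ))),
    ← integral_const_mul, ← integral_const_mul]
  congr 1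
  funext w
  have e1 : ∑ k : Fin (n + 1), (c k.rev / √v) * (√v • w) k = ∑ k, c k * w k.rev := by
    rw [← Equiv.sum_comp Fin.revPerm]
    refine Finset.sum_congr rfl fun k _ => ?_
    simp only [Fin.revPerm_apply, Fin.rev_rev, Pi.smul_apply, smul_eq_mul]
    field_simp
  have e2 : excDensity n (fun i => v * (1 - t i.rev.succ.castSucc)) (√v • w) =
      √(8 * π) * (v⁻¹ * ellF (TAux t r (Fin.last (n + 1))) (w 0)) *
       (v⁻¹ * ellF (TAux t r 0) (w (Fin.last n))) *
        (((√v)⁻¹) ^ n * ∏ k : Fin n, gF (TAux t r k.castSucc.succ) (w k.castSucc.rev) (w k.succ.rev)) := by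
    unfold excDensity
    rw [← ell_scale hv (hT _), ← ell_scale hv (hT _)]
    congr 1
    · congr 2
      · simp only [Pi.smul_apply, smul_eq_mul]
        congr 1
        rw [TAux, if_neg (Fin.last_pos).ne', Fin.rev_zero, Fin.succ_last, Fin.succ_last, htlast, add_zero]
      · simp only [Pi.smul_apply, smul_eq_mul]
        rw [TAux, if_pos rfl, Fin.rev_last, Fin.castSucc_zero, ht0, Fin.castSucc_succ]
        rw [Fin.castSucc_zero]
        linear_combination -hvr
    · rw [← Equiv.prod_comp Fin.revPerm]
      have : (√v)⁻¹ ^ n = ∏ k : Fin n, (√v)⁻¹ := by simp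
      rw [this, ← Finset.prod_mul_distrib]
      refine Finset.prod_congr rfl fun k _ => ?_
      rw [← g_scale hv, g_symm]
      simp only [Fin.revPerm_apply, Pi.smul_apply, smul_eq_mul, Fin.rev_succ, Fin.rev_castSucc,
        Fin.rev_rev]
      congr 1
      rw [TAux, if_neg (Fin.succ_ne_zero _), add_zero, ← mul_sub]
      congr 1
      rw [sub_sub_sub_cancel_left]
      rfl
  beta_reduce
  rw [e1, e2, Fin.rev_last, Fin.rev_zero]
  have hp : √v ^ (n + 1) * (√v)⁻¹ ^ n = √v := by
    rw [pow_succ, inv_pow]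
    field_simp
  have hq : (v ^ 2)⁻¹ = v⁻¹ * v⁻¹ := by rw [sq, mul_inv]
  rw [hq]
  linear_combination (Real.exp (-∑ k, c k * w k.rev) * √(8 * π) * v⁻¹ * v⁻¹ *
     ellF (TAux t r (Fin.last (n + 1))) (w 0) * ellF (TAux t r 0) (w (Fin.last n)) *
     ∏ k : Fin n, gF (TAux t r k.castSucc.succ) (w k.castSucc.rev) (w k.succ.rev)) * hp

lemma transP_nonneg {c x y : ℝ} (hc : 0 ≤ c) (hx : 0 ≤ x) (hy : 0 ≤ y) : 0 ≤ transP c x y := by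
  unfold transP; positivity

lemma subst_v (G : ℝ → ℝ) :
    ∫ v in Set.Ioo (0:ℝ) 1, G v = ∫ r in Set.Ioi (0:ℝ), ((1 + r)⁻¹) ^ 2 * G ((1 + r)⁻¹) := by
  have him : (fun r : ℝ => (1 + r)⁻¹) '' Set.Ioi 0 = Set.Ioo 0 1 := by
    ext v
    constructor
    · rintro ⟨r, hr, rfl⟩
      have hr : 0 < r := hr
      exact ⟨by positivity, inv_lt_one_of_one_lt₀ (by linarith)⟩
    · rintro ⟨h0, h1⟩
      refine ⟨v⁻¹ - 1, ?_, by simp⟩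
      have := one_lt_inv_iff₀.2 ⟨h0, h1⟩
      simp only [Set.mem_Ioi]; linarith
  rw [← him, integral_image_eq_integral_abs_deriv_smul (f' := fun r => -((1 + r)⁻¹) ^ 2)
    measurableSet_Ioi]
  · refine setIntegral_congr_fun measurableSet_Ioi fun r _ => ?_
    simp only [abs_neg, smul_eq_mul]
    rw [abs_of_nonneg (by positivity)]
  · intro r hr
    have hr : 0 < r := hr
    have h := ((hasDerivAt_id r).const_add 1).fun_inv (by simp only [id]; positivity)
    refine (h.congr_deriv ?_).hasDerivWithinAt
    simp only [id]
    rw [inv_pow]; ring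
  · intro a _ b _ h
    have := inv_injective h
    linarith

lemma TAux_sum {n : ℕ} (t : Fin (n + 3) → ℝ) (r : ℝ) (x : Fin (n + 2) → ℝ) :
    ∑ k, TAux t r k * x k = (∑ k : Fin (n + 2), (t k.succ - t k.castSucc) * x k) + r * x 0 := by
  simp only [TAux, add_mul, Finset.sum_add_distrib]
  congr 1
  simp

lemma gamma_r {a x : ℝ} (ha : 0 < a) (hx : 0 < x) :
    ∫ r in Set.Ioi (0:ℝ), r ^ (a - 1) * Real.exp (-(1/2) * (r * x)) =
      2 ^ a * Real.Gamma a * x ^ (-a) := by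
  have := Real.integral_rpow_mul_exp_neg_mul_Ioi ha (half_pos hx)
  rw [show (1 / (x / 2)) ^ a * Real.Gamma a = 2 ^ a * Real.Gamma a * x ^ (-a) by
    rw [one_div_div, Real.div_rpow (by norm_num) hx.le, Real.rpow_neg hx.le]; ring] at this
  rw [← this]
  refine integral_congr_ae (Filter.Eventually.of_forall fun r => ?_)
  simp only
  congr 2; ring

/-- **Dual representation for generalized Bessel meanders of dimensions `(δ, 3−δ)`.**
Here `δ ∈ (0,3)`, `ν` is the `Beta(δ/2,(3−δ)/2)` distribution with density
`v^{δ/2−1}(1−v)^{(1−δ)/2}/B(δ/2,(3−δ)/2)` on `(0,1)`, where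
`B(α,β) = Γ(α)Γ(β)/Γ(α+β)`; `d = n + 1 ≥ 1`, `s₀ = 0 < s₁ < … < s_d`,
`t₀ = 0 ≤ t₁ < … < t_d < 1 = t_{d+1}`. -/
theorem bessel_meander_dual (δ : ℝ) (hδ0 : 0 < δ) (hδ3 : δ < 3)
    (n : ℕ) (s : Fin (n + 2) → ℝ) (t : Fin (n + 3) → ℝ)
    (hs0 : s 0 = 0) (hs : StrictMono s)
    (ht0 : t 0 = 0) (htlast : t (Fin.last (n + 2)) = 1)
    (ht1 : 0 ≤ t 1)
    (htmono : StrictMonoOn t (Set.Icc (1 : Fin (n + 3)) ⟨n + 1, by omega⟩))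
    (htd : t ⟨n + 1, by omega⟩ < 1) :
    (∫ v in Set.Ioo (0 : ℝ) 1,
        (∫ u : Fin (n + 1) → ℝ in Set.univ.pi fun _ => Set.Ioi (0 : ℝ),
          Real.exp (-(∑ k : Fin (n + 1),
              ((s k.rev.succ - s k.rev.castSucc) / Real.sqrt v) * u k)) *
            excDensity n (fun i => v * (1 - t i.rev.succ.castSucc)) u) *
          (v ^ (δ / 2 - 1) * (1 - v) ^ ((1 - δ) / 2) /
            (Real.Gamma (δ / 2) * Real.Gamma ((3 - δ) / 2) /
              Real.Gamma (δ / 2 + (3 - δ) / 2)))) =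
      (1 / ((2 : ℝ) ^ (δ / 2) * Real.Gamma (δ / 2))) *
        ∫ x : Fin (n + 2) → ℝ in Set.univ.pi fun _ => Set.Ioi (0 : ℝ),
          x 0 ^ (δ / 2 - 1) *
            Real.exp (-(1 / 2 : ℝ) * ∑ k : Fin (n + 2), (t k.succ - t k.castSucc) * x k) *
            ∏ k : Fin (n + 1), transP (s k.succ - s k.castSucc) (x k.castSucc) (x k.succ) := by

  have hT : ∀ r, 0 < r → ∀ j, 0 < TAux t r j := fun r hr =>
    TAux_pos t ht0 htlast ht1 htmono htd hr
  set c : Fin (n + 1) → ℝ := fun k => s k.succ - s k.castSucc with hcdef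
  have hc : ∀ k, 0 < c k := fun k => sub_pos.2 (hs Fin.castSucc_lt_succ)
  have ha : 0 < (3 - δ) / 2 := by linarith
  have hG1 := Real.Gamma_pos_of_pos (show 0 < δ / 2 by linarith)
  have hG2 := Real.Gamma_pos_of_pos ha
  have hG3 : Real.Gamma (δ / 2 + (3 - δ) / 2) = √π / 2 := by
    rw [show δ / 2 + (3 - δ) / 2 = 1 / 2 + 1 by ring, Real.Gamma_add_one (by norm_num),
      Real.Gamma_one_half_eq]
    ring
  set D : ℝ := Real.Gamma (δ / 2) * Real.Gamma ((3 - δ) / 2) /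
    Real.Gamma (δ / 2 + (3 - δ) / 2) with hD
  rw [subst_v]
  -- the integrand in `(r, x)`
  let f : ℝ → (Fin (n + 2) → ℝ) → ℝ := fun r x =>
    r ^ ((3 - δ) / 2 - 1) * (√(x 0) * Real.exp (-(1/2:ℝ) * ∑ k, TAux t r k * x k) *
      ∏ k : Fin (n + 1), transP (c k) (x k.castSucc) (x k.succ))
  have hL : ∀ r ∈ Set.Ioi (0:ℝ), ((1 + r)⁻¹) ^ 2 *
      ((∫ u : Fin (n + 1) → ℝ in Set.univ.pi fun _ => Set.Ioi (0 : ℝ),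
          Real.exp (-(∑ k : Fin (n + 1),
              ((s k.rev.succ - s k.rev.castSucc) / Real.sqrt ((1 + r)⁻¹)) * u k)) *
            excDensity n (fun i => (1 + r)⁻¹ * (1 - t i.rev.succ.castSucc)) u) *
          (((1 + r)⁻¹) ^ (δ / 2 - 1) * (1 - (1 + r)⁻¹) ^ ((1 - δ) / 2) / D)) =
      √(8 * π) / D / (4 * π) * ∫ x, f r x ∂(Measure.pi fun _ : Fin (n + 2) =>
        (volume : Measure ℝ).restrict (Set.Ioi 0)) := by
    intro r hr
    have hr : 0 < r := hr
    obtain ⟨v, hv⟩ : ∃ v, v = (1 + r)⁻¹ := ⟨_, rfl⟩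
    have hv0 : 0 < v := by rw [hv]; positivity
    have hvr : v * (1 + r) = 1 := by rw [hv]; field_simp
    rw [← hv]
    have h1 := inner_eq t c ht0 htlast hv0 hvr (hT r hr)
    have h2 := core_eq n (TAux t r) c (hT r hr) hc
    simp only [hcdef] at h1
    rw [h1]
    simp only [f]
    rw [integral_const_mul, h2]
    have h3 : 1 - v = r * v := by linarith
    have h4 : √v * (v ^ (δ / 2 - 1) * (1 - v) ^ ((1 - δ) / 2)) = r ^ ((3 - δ) / 2 - 1) := by
      rw [h3, Real.mul_rpow hr.le hv0.le, Real.sqrt_eq_rpow]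
      have : v ^ (1/2 : ℝ) * (v ^ (δ / 2 - 1) * v ^ ((1 - δ) / 2)) = 1 := by
        rw [← Real.rpow_add hv0, ← Real.rpow_add hv0]
        rw [show 1/2 + (δ / 2 - 1 + (1 - δ) / 2) = 0 by ring, Real.rpow_zero]
      rw [show (3 - δ) / 2 - 1 = (1 - δ) / 2 by ring]
      linear_combination r ^ ((1 - δ) / 2) * this
    rw [← h4]
    simp only [hcdef]
    have hv2 : v ^ 2 ≠ 0 := by positivity
    field_simp
  rw [setIntegral_congr_fun measurableSet_Ioi hL, integral_const_mul]
  have hx0 := ae_pos (n + 2)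
  have hfn : ∀ r, 0 < r → ∀ x : Fin (n + 2) → ℝ, (∀ j, 0 < x j) → 0 ≤ f r x := by
    intro r hr x hx
    have : 0 ≤ ∏ k : Fin (n + 1), transP (c k) (x k.castSucc) (x k.succ) :=
      Finset.prod_nonneg fun k _ => transP_nonneg (hc k).le (hx _).le (hx _).le
    simp only [f]
    positivity
  have hr0 : ∀ᵐ r ∂((volume : Measure ℝ).restrict (Set.Ioi 0)), 0 < r :=
    ae_restrict_mem measurableSet_Ioi
  have hfr : ∀ r x, f r x = (√(x 0) *
      Real.exp (-(1/2:ℝ) * ∑ k : Fin (n + 2), (t k.succ - t k.castSucc) * x k) *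
      ∏ k : Fin (n + 1), transP (c k) (x k.castSucc) (x k.succ)) *
      (r ^ ((3 - δ) / 2 - 1) * Real.exp (-(1/2) * (r * x 0))) := by
    intro r x
    simp only [f]
    rw [TAux_sum, mul_add, Real.exp_add]
    ring
  rw [swap_nonneg_aux]
  · have hR : ∀ x : Fin (n + 2) → ℝ, (∀ j, 0 < x j) →
        ∫ r in Set.Ioi (0:ℝ), f r x = (2 ^ ((3 - δ) / 2) * Real.Gamma ((3 - δ) / 2)) *
        (x 0 ^ (δ / 2 - 1) *
            Real.exp (-(1 / 2 : ℝ) * ∑ k : Fin (n + 2), (t k.succ - t k.castSucc) * x k) *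
            ∏ k : Fin (n + 1), transP (c k) (x k.castSucc) (x k.succ)) := by
      intro x hx
      simp only [hfr]
      rw [integral_const_mul, gamma_r ha (hx 0)]
      have : √(x 0) * x 0 ^ (-((3 - δ) / 2)) = x 0 ^ (δ / 2 - 1) := by
        rw [Real.sqrt_eq_rpow, ← Real.rpow_add (hx 0)]; congr 1; ring
      rw [← this]
      ring
    rw [integral_congr_ae (hx0.mono hR), integral_const_mul, ← pi_restrict_eq, ← mul_assoc]
    congr 1
    rw [hD, hG3]
    have e8 : √(8 * π) = 2 * √2 * √π := by
      rw [show 8 * π = 2 ^ 2 * 2 * π by ring, Real.sqrt_mul (by positivity),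
        Real.sqrt_mul (by positivity), Real.sqrt_sq (by norm_num)]
    have e2 : (2:ℝ) ^ ((3 - δ) / 2) * 2 ^ (δ / 2) = 2 * √2 := by
      rw [← Real.rpow_add two_pos, show (3 - δ) / 2 + δ / 2 = 1 + 1 / 2 by ring,
        Real.rpow_add two_pos, Real.rpow_one, Real.sqrt_eq_rpow]
    have e3 : (2:ℝ) ^ ((3 - δ) / 2) = 2 * √2 / 2 ^ (δ / 2) := by
      rw [← e2]; field_simp
    rw [e8, e3]
    have hp := Real.sq_sqrt Real.pi_pos.le
    have h2 := Real.sq_sqrt (show (0:ℝ) ≤ 2 by norm_num)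
    have hsp : √π ≠ 0 := by positivity
    field_simp
    rw [hp, h2]
    ring
  · apply Measurable.aestronglyMeasurable
    have hu : Function.uncurry f = fun p => _ := funext fun p => hfr p.1 p.2
    rw [hu]
    simp only [transP]
    fun_prop
  · exact hr0.mono fun r hr => hx0.mono fun x hx => hfn r hr x hx
  · exact hx0.mono fun x hx => hr0.mono fun r hr => hfn r hr x hx
  · refine hr0.mono fun r hr => ?_
    exact (core_integrable n (TAux t r) c (hT r hr) hc).const_mul _
  · refine hx0.mono fun x hx => ?_
    simp only [hfr]
    refine Integrable.const_mul ?_ _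
    have := integrableOn_rpow_mul_exp_neg_mul_rpow (p := 1) (s := (3 - δ) / 2 - 1)
      (b := x 0 / 2) (by linarith) one_pos (half_pos (hx 0))
    refine this.congr (Filter.Eventually.of_forall fun r => ?_)
    simp only [Real.rpow_one]
    congr 2; ring
end

section
/- Dual representation of the Brownian meander: Let d ≥ 1, 0 = s₀ < s₁ < … < s_d, and 0 ≤ t₁ < t₂ < … < t_d < 1 with t₀ = 0 and t_{d+1} = 1. Then ∫_0^1 [ ∫_{(0,∞)^d} exp(−∑_{k=1}^d ((s_{d+1−k} − s_{d−k})/√v) · u_k) · f_{v(1−t_d),…,v(1−t₁)}(u₁,…,u_d) du₁…du_d ] · (1/(2√v)) dv = (1/√(2π)) · ∫_{(0,∞)^{d+1}} x₀^{−1/2} · exp(−(1/2) ∑_{k=0}^d (t_{k+1} − t_k) x_k) · ∏_{k=1}^d p_{s_k − s_{k−1}}(x_{k−1}, x_k) dx₀ dx₁ … dx_d. (The left-hand side is the Laplace transform E[exp(−∑_{k=1}^d (s_k − s_{k−1}) B^{me}_{1−t_k})] of the Brownian meander, using the representation of the Brownian meander as B^{me}_t = V^{−1/2} B^{ex}_{Vt}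 with V Beta(1/2, 1)-distributed, i.e. with density (2√v)^{−1} on (0,1), independent of the Brownian excursion.) -/
open MeasureTheory Real Finset

lemma md_integrable_exp_cos (a b : ℝ) (ha : 0 < a) :
    IntegrableOn (fun u : ℝ => Real.exp (-(a * u)) * Real.cos (b * u)) (Set.Ioi 0) := by
  have h : IntegrableOn (fun u : ℝ => Real.exp (-a * u)) (Set.Ioi 0) :=
    integrableOn_exp_mul_Ioi (by linarith) 0
  refine Integrable.mono h (by fun_prop) (Filter.Eventually.of_forall fun u => ?_)
  simp only [norm_mul, Real.norm_eq_abs, abs_exp, neg_mul]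
  exact mul_le_of_le_one_right (exp_pos _).le (abs_cos_le_one _)

lemma md_integral_exp_cos (a b : ℝ) (ha : 0 < a) :
    ∫ u in Set.Ioi (0 : ℝ), Real.exp (-(a * u)) * Real.cos (b * u) = a / (a ^ 2 + b ^ 2) := by
  have hD : (0 : ℝ) < a ^ 2 + b ^ 2 := by positivity
  have h := integral_Ioi_of_hasDerivAt_of_tendsto'
    (f := fun u : ℝ => Real.exp (-(a * u)) * (b * Real.sin (b * u) - a * Real.cos (b * u)) /
      (a ^ 2 + b ^ 2)) (a := 0) (m := 0)
    (f' := fun u : ℝ => Real.exp (-(a * u)) * Real.cos (b * u)) ?_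
    (md_integrable_exp_cos a b ha) ?_
  · rw [h]; simp; field_simp
  · intro u _
    have e1 : HasDerivAt (fun u : ℝ => Real.exp (-(a * u))) (Real.exp (-(a * u)) * (-a)) u := by
      have := ((hasDerivAt_id u).const_mul a).neg.exp
      simpa using this
    have e2 : HasDerivAt (fun u : ℝ => Real.sin (b * u)) (Real.cos (b * u) * b) u := by
      simpa using ((hasDerivAt_id u).const_mul b).sin
    have e3 : HasDerivAt (fun u : ℝ => Real.cos (b * u)) (-Real.sin (b * u) * b) u := by
      simpa using ((hasDerivAt_id u).const_mul b).cos
    have := (e1.mul ((e2.const_mul b).sub (e3.const_mul a))).div_const (a ^ 2 + b ^ 2)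
    refine this.congr_deriv ?_
    simp only [Pi.sub_apply]
    field_simp
    ring
  · have h0 : Filter.Tendsto (fun u : ℝ => Real.exp (-(a * u)) * ((|b| + |a|) / (a ^ 2 + b ^ 2)))
        Filter.atTop (nhds 0) := by
      rw [show (0 : ℝ) = 0 * ((|b| + |a|) / (a ^ 2 + b ^ 2)) by simp]
      refine Filter.Tendsto.mul_const _ ?_
      exact Real.tendsto_exp_neg_atTop_nhds_zero.comp (Filter.tendsto_id.const_mul_atTop ha)
    refine squeeze_zero_norm (fun u => ?_) h0
    rw [Real.norm_eq_abs, mul_div_assoc, abs_mul, abs_exp, abs_div, abs_of_pos hD]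
    gcongr
    refine (abs_sub _ _).trans ?_
    rw [abs_mul, abs_mul]
    gcongr
    · exact mul_le_of_le_one_right (abs_nonneg _) (abs_sin_le_one _)
    · exact mul_le_of_le_one_right (abs_nonneg _) (abs_cos_le_one _)

/-- Laplace transform of a product of sines gives the kernel `transP`. -/
lemma md_transP_eq (a x y : ℝ) (ha : 0 < a) (hx : 0 < x) (hy : 0 < y) :
    ∫ u in Set.Ioi (0 : ℝ), Real.exp (-(a * u)) * (Real.sin (√x * u) / (π * √x)) *
      Real.sin (√y * u) = transP a x y := by
  have h1 : ∀ u : ℝ, Real.exp (-(a * u)) * (Real.sin (√x * u) / (π * √x)) * Real.sin (√y * u) =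
      (1 / (2 * π * √x)) * (Real.exp (-(a * u)) * Real.cos ((√x - √y) * u) -
        Real.exp (-(a * u)) * Real.cos ((√x + √y) * u)) := by
    intro u
    rw [sub_mul, add_mul, cos_sub, cos_add]
    have := sqrt_pos.2 hx
    field_simp
    ring
  simp_rw [h1]
  rw [integral_const_mul, integral_sub (md_integrable_exp_cos _ _ ha)
    (md_integrable_exp_cos _ _ ha), md_integral_exp_cos _ _ ha, md_integral_exp_cos _ _ ha, transP]
  have hp := sqrt_pos.2 hx
  have hq := sqrt_pos.2 hy
  set p := √x
  set q := √y
  have ex : x = p ^ 2 := (Real.sq_sqrt hx.le).symm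
  have ey : y = q ^ 2 := (Real.sq_sqrt hy.le).symm
  rw [ex, ey]
  have k1 : 0 < a ^ 2 + (p - q) ^ 2 := by positivity
  have k2 : 0 < a ^ 2 + (p + q) ^ 2 := by positivity
  have k3 : (q ^ 2 - p ^ 2) ^ 2 + 2 * (p ^ 2 + q ^ 2) * a ^ 2 + a ^ 4 =
    (a ^ 2 + (p - q) ^ 2) * (a ^ 2 + (p + q) ^ 2) := by ring
  rw [k3]
  field_simp
  ring

lemma md_integrable_gauss (c : ℝ) (hc : 0 < c) :
    IntegrableOn (fun z : ℝ => Real.exp (-(c / 2 * z ^ 2))) (Set.Ioi 0) := by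
  have := (integrable_exp_neg_mul_sq (b := c / 2) (by positivity)).integrableOn (s := Set.Ioi (0:ℝ))
  simpa using this

lemma md_integrable_gauss_cos (c b : ℝ) (hc : 0 < c) :
    IntegrableOn (fun z : ℝ => Real.exp (-(c / 2 * z ^ 2)) * Real.cos (b * z)) (Set.Ioi 0) := by
  refine Integrable.mono (md_integrable_gauss c hc) (by fun_prop)
    (Filter.Eventually.of_forall fun u => ?_)
  simp only [norm_mul, Real.norm_eq_abs, abs_exp]
  exact mul_le_of_le_one_right (exp_pos _).le (abs_cos_le_one _)

lemma md_integral_gauss_cos (c b : ℝ) (hc : 0 < c) :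
    ∫ z in Set.Ioi (0 : ℝ), Real.exp (-(c / 2 * z ^ 2)) * Real.cos (b * z) =
      1 / 2 * √(2 * π / c) * Real.exp (-(b ^ 2) / (2 * c)) := by
  have h := fourierIntegral_gaussian (b := ((c / 2 : ℝ) : ℂ)) (by simpa using hc) (b : ℂ)
  have h2 := integral_comp_abs (f := fun z => Real.exp (-(c / 2 * z ^ 2)) * Real.cos (b * z))
  have h3 : ∫ z : ℝ, Real.exp (-(c / 2 * |z| ^ 2)) * Real.cos (b * |z|) =
      (∫ x : ℝ, Complex.exp (Complex.I * b * x) * Complex.exp (-((c / 2 : ℝ) : ℂ) * x ^ 2)).re := by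
    have hi : Integrable (fun x : ℝ => Complex.exp (Complex.I * b * x) *
        Complex.exp (-((c / 2 : ℝ) : ℂ) * x ^ 2)) := by
      refine (integrable_exp_neg_mul_sq (b := c / 2) (by positivity)).mono
        (by fun_prop) (Filter.Eventually.of_forall fun x => ?_)
      rw [norm_mul, Complex.norm_exp, Complex.norm_exp, Real.norm_eq_abs, abs_exp]
      norm_cast
      simp
    have := integral_re hi
    simp only [RCLike.re_to_complex] at this
    rw [← this]
    congr 1
    ext x
    rw [sq_abs, show Complex.exp (-((c / 2 : ℝ) : ℂ) * x ^ 2) =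
      ((Real.exp (-(c / 2 * x ^ 2)) : ℝ) : ℂ) by push_cast; congr 1; ring, Complex.re_mul_ofReal,
      Complex.exp_re]
    have : Real.cos (b * |x|) = Real.cos (b * x) := by
      rcases abs_cases x with ⟨h, _⟩ | ⟨h, _⟩ <;> rw [h]
      rw [mul_neg, cos_neg]
    rw [this]
    simp [mul_comm]
  have h4 : ((π : ℂ) / ((c / 2 : ℝ) : ℂ)) ^ (1 / 2 : ℂ) *
      Complex.exp (-(b : ℂ) ^ 2 / (4 * ((c / 2 : ℝ) : ℂ))) =
      ((√(2 * π / c) * Real.exp (-(b ^ 2) / (2 * c)) : ℝ) : ℂ) := by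
    rw [Real.sqrt_eq_rpow, Complex.ofReal_mul, Complex.ofReal_cpow (by positivity)]
    push_cast
    congr 2
    · field_simp
    · ring_nf
  rw [h, h4, Complex.ofReal_re] at h3
  rw [h3] at h2
  linarith

lemma md_subst_sq (f : ℝ → ℝ) :
    ∫ x in Set.Ioi (0 : ℝ), f x = ∫ z in Set.Ioi (0 : ℝ), 2 * z * f (z ^ 2) := by
  rw [← integral_comp_rpow_Ioi_of_pos (g := f) (p := 2) (by norm_num)]
  refine setIntegral_congr_fun measurableSet_Ioi fun z _ => ?_
  simp only [smul_eq_mul]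
  norm_num

/-- the middle kernel -/
lemma md_gF_eq (c u w : ℝ) (hc : 0 < c) (hu : 0 < u) (hw : 0 < w) :
    ∫ x in Set.Ioi (0 : ℝ), Real.exp (-(c / 2 * x)) * (Real.sin (√x * w) / (π * √x)) *
      Real.sin (√x * u) = gF c u w := by
  rw [md_subst_sq]
  have h1 : ∀ z ∈ Set.Ioi (0 : ℝ), 2 * z * (Real.exp (-(c / 2 * z ^ 2)) *
      (Real.sin (√(z ^ 2) * w) / (π * √(z ^ 2))) * Real.sin (√(z ^ 2) * u)) =
      (1 / π) * (Real.exp (-(c / 2 * z ^ 2)) * Real.cos ((u - w) * z) -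
        Real.exp (-(c / 2 * z ^ 2)) * Real.cos ((u + w) * z)) := by
    intro z hz
    have hz : 0 < z := hz
    rw [Real.sqrt_sq hz.le, sub_mul, add_mul, cos_sub, cos_add, mul_comm z w, mul_comm z u]
    field_simp
    ring
  rw [setIntegral_congr_fun measurableSet_Ioi h1, integral_const_mul,
    integral_sub (md_integrable_gauss_cos _ _ hc) (md_integrable_gauss_cos _ _ hc),
    md_integral_gauss_cos _ _ hc, md_integral_gauss_cos _ _ hc, gF, if_pos ⟨hu, hw⟩]
  have : 1 / √(2 * π * c) = 1 / π * (1 / 2 * √(2 * π / c)) := by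
    rw [Real.sqrt_div (by positivity), Real.sqrt_mul (by positivity) c]
    have := sqrt_pos.2 hc
    have h2 : 0 < √(2 * π) := by positivity
    have h3 : √(2 * π) ^ 2 = 2 * π := Real.sq_sqrt (by positivity)
    field_simp
    rw [h3]
  rw [this]
  ring

/-- the last kernel -/
lemma md_ellF_eq (c u : ℝ) (hc : 0 < c) (hu : 0 < u) :
    ∫ x in Set.Ioi (0 : ℝ), Real.exp (-(c / 2 * x)) * Real.sin (√x * u) = 2 * π * ellF c u := by
  rw [md_subst_sq]
  have hint1 : IntegrableOn (fun z : ℝ => z * Real.exp (-(c / 2 * z ^ 2)) * Real.sin (u * z))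
      (Set.Ioi 0) := by
    have h0 : IntegrableOn (fun z : ℝ => z * Real.exp (-(c / 2) * z ^ 2)) (Set.Ioi 0) :=
      (integrable_mul_exp_neg_mul_sq (b := c / 2) (by positivity)).integrableOn
    refine Integrable.mono h0 (by fun_prop) (Filter.Eventually.of_forall fun z => ?_)
    rw [norm_mul, neg_mul]
    exact mul_le_of_le_one_right (norm_nonneg _) (abs_sin_le_one _)
  have hint2 := (md_integrable_gauss_cos c u hc).const_mul (u / c)
  have h := integral_Ioi_of_hasDerivAt_of_tendsto'
    (f := fun z : ℝ => -(1 / c) * (Real.exp (-(c / 2 * z ^ 2)) * Real.sin (u * z))) (a := 0) (m := 0)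
    (f' := fun z : ℝ => z * Real.exp (-(c / 2 * z ^ 2)) * Real.sin (u * z) -
      u / c * (Real.exp (-(c / 2 * z ^ 2)) * Real.cos (u * z))) ?_
    (hint1.sub hint2) ?_
  · rw [integral_sub hint1 hint2, integral_const_mul, md_integral_gauss_cos _ _ hc] at h
    have h1 : ∀ z ∈ Set.Ioi (0 : ℝ), 2 * z * (Real.exp (-(c / 2 * z ^ 2)) *
      Real.sin (√(z ^ 2) * u)) = 2 * (z * Real.exp (-(c / 2 * z ^ 2)) * Real.sin (u * z)) := by
      intro z hz
      have hz : 0 < z := hz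
      rw [Real.sqrt_sq hz.le, mul_comm z u]
      ring
    rw [setIntegral_congr_fun measurableSet_Ioi h1, integral_const_mul]
    simp only [mul_zero, Real.sin_zero, sub_zero] at h
    rw [sub_eq_zero.1 h, ellF, if_pos hu, Real.sqrt_div (by positivity),
      Real.sqrt_mul (by positivity) (c ^ 3), show c ^ 3 = c ^ 2 * c by ring,
      Real.sqrt_mul (by positivity) c, Real.sqrt_sq hc.le]
    have := sqrt_pos.2 hc
    have h2 : 0 < √(2 * π) := by positivity
    have h3 : √(2 * π) ^ 2 = 2 * π := Real.sq_sqrt (by positivity)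
    field_simp
    rw [h3]
  · intro z _
    have e1 : HasDerivAt (fun z : ℝ => Real.exp (-(c / 2 * z ^ 2)))
        (Real.exp (-(c / 2 * z ^ 2)) * (-(c * z))) z := by
      have := ((hasDerivAt_pow 2 z).const_mul (c / 2)).neg.exp
      refine this.congr_deriv ?_
      simp [Pi.neg_apply]; ring
    have e2 : HasDerivAt (fun z : ℝ => Real.sin (u * z)) (Real.cos (u * z) * u) z := by
      simpa using ((hasDerivAt_id z).const_mul u).sin
    refine ((e1.mul e2).const_mul (-(1 / c))).congr_deriv ?_
    field_simp
    ring
  · have h0 : Filter.Tendsto (fun z : ℝ => (1 / c) * Real.exp (-(c / 2 * z ^ 2)))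
        Filter.atTop (nhds 0) := by
      rw [show (0 : ℝ) = 1 / c * 0 by simp]
      refine Filter.Tendsto.const_mul _ ?_
      exact Real.tendsto_exp_neg_atTop_nhds_zero.comp
        ((Filter.tendsto_pow_atTop two_ne_zero).const_mul_atTop (by positivity))
    refine squeeze_zero_norm (fun z => ?_) h0
    rw [norm_mul, norm_neg, norm_mul, Real.norm_of_nonneg (by positivity : 0 ≤ 1 / c),
      Real.norm_eq_abs, abs_exp]
    gcongr
    exact mul_le_of_le_one_right (exp_pos _).le (abs_sin_le_one _)

noncomputable def mdEf (X : ℝ) : ℝ := ∫ y in (0 : ℝ)..X, Real.exp (-(1 / 2 * y ^ 2))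

noncomputable def mdHf (c u : ℝ) : ℝ := if c = 0 then 1 else √(2 / π) * mdEf (u / √c)

lemma mdEf_hasDerivAt (X : ℝ) : HasDerivAt mdEf (Real.exp (-(1 / 2 * X ^ 2))) X := by
  have hc : Continuous fun y : ℝ => Real.exp (-(1 / 2 * y ^ 2)) := by fun_prop
  exact hc.integral_hasStrictDerivAt 0 X |>.hasDerivAt

lemma mdEf_continuous : Continuous mdEf :=
  continuous_iff_continuousAt.2 fun X => (mdEf_hasDerivAt X).continuousAt

lemma mdEf_zero : mdEf 0 = 0 := by simp [mdEf]

lemma mdEf_tendsto : Filter.Tendsto mdEf Filter.atTop (nhds √(π / 2)) := by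
  have h := intervalIntegral_tendsto_integral_Ioi 0 (md_integrable_gauss 1 one_pos)
    Filter.tendsto_id
  have e : ∫ x in Set.Ioi (0 : ℝ), Real.exp (-(1 / 2 * x ^ 2)) = √(π / 2) := by
    have := integral_gaussian_Ioi (1 / 2)
    simp only [neg_mul] at this
    rw [this]
    rw [show π / (1 / 2) = 2 ^ 2 * (π / 2) by ring, Real.sqrt_mul (by positivity),
      Real.sqrt_sq (by norm_num)]
    ring
  rw [e] at h
  exact h

lemma mdEf_mono : Monotone mdEf :=
  monotone_of_hasDerivAt_nonneg mdEf_hasDerivAt fun _ => (exp_pos _).le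

lemma mdEf_nonneg (X : ℝ) (hX : 0 ≤ X) : 0 ≤ mdEf X := by
  rw [← mdEf_zero]; exact mdEf_mono hX

lemma mdEf_le (X : ℝ) : mdEf X ≤ √(π / 2) :=
  mdEf_mono.ge_of_tendsto mdEf_tendsto X

lemma md_sqrt_const : √(2 / π) * √(π / 2) = 1 := by
  rw [← Real.sqrt_mul (by positivity)]
  rw [show 2 / π * (π / 2) = 1 by field_simp]
  simp

lemma mdHf_nonneg (c u : ℝ) (hu : 0 ≤ u) : 0 ≤ mdHf c u := by
  unfold mdHf
  split_ifs
  · exact zero_le_one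
  · exact mul_nonneg (by positivity) (mdEf_nonneg _ (by positivity))

lemma mdHf_le (c u : ℝ) : mdHf c u ≤ 1 := by
  unfold mdHf
  split_ifs
  · exact le_rfl
  · rw [← md_sqrt_const]
    gcongr
    exact mdEf_le _

lemma mdHf_measurable (c : ℝ) : Measurable (mdHf c) := by
  unfold mdHf
  split_ifs
  · exact measurable_const
  · have := mdEf_continuous
    fun_prop

lemma mdHf_tendsto (u : ℝ) (hu : 0 < u) :
    Filter.Tendsto (fun m : ℕ => mdHf (1 / ((m : ℝ) + 1)) u) Filter.atTop (nhds (mdHf 0 u)) := by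
  have h1 : ∀ m : ℕ, mdHf (1 / ((m : ℝ) + 1)) u = √(2 / π) * mdEf (u * √((m : ℝ) + 1)) := by
    intro m
    have : (0 : ℝ) < (m : ℝ) + 1 := by positivity
    rw [mdHf, if_neg (by positivity)]
    simp
  simp_rw [h1]
  rw [mdHf, if_pos rfl, ← md_sqrt_const]
  refine Filter.Tendsto.const_mul _ (mdEf_tendsto.comp ?_)
  refine Filter.Tendsto.const_mul_atTop hu (Real.tendsto_sqrt_atTop.comp ?_)
  exact Filter.tendsto_atTop_add_const_right _ _ tendsto_natCast_atTop_atTop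

lemma mdHf_eq (c u : ℝ) (hc : 0 < c) (hu : 0 < u) :
    ∫ x in Set.Ioi (0 : ℝ), Real.exp (-(c / 2 * x)) * (Real.sin (√x * u) / (π * √x)) *
      x ^ (-(1 : ℝ) / 2) = mdHf c u := by
  rw [md_subst_sq]
  have h1 : ∀ z ∈ Set.Ioi (0 : ℝ), 2 * z * (Real.exp (-(c / 2 * z ^ 2)) *
      (Real.sin (√(z ^ 2) * u) / (π * √(z ^ 2))) * (z ^ 2) ^ (-(1 : ℝ) / 2)) =
      (2 / π) * ∫ b in Set.Ioc (0 : ℝ) u, Real.exp (-(c / 2 * z ^ 2)) * Real.cos (b * z) := by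
    intro z hz
    have hz : 0 < z := hz
    have e1 : ∫ b in Set.Ioc (0 : ℝ) u, Real.exp (-(c / 2 * z ^ 2)) * Real.cos (b * z) =
        Real.exp (-(c / 2 * z ^ 2)) * (Real.sin (u * z) / z) := by
      rw [integral_const_mul, ← intervalIntegral.integral_of_le hu.le,
        intervalIntegral.integral_comp_mul_right _ hz.ne']
      simp
      field_simp
    have e2 : (z ^ 2) ^ (-(1 : ℝ) / 2) = 1 / z := by
      rw [← Real.rpow_natCast, ← Real.rpow_mul hz.le]
      norm_num
      rw [Real.rpow_neg_one]
    rw [e1, e2, Real.sqrt_sq hz.le, mul_comm z u]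
    field_simp
  rw [setIntegral_congr_fun measurableSet_Ioi h1, integral_const_mul, integral_integral_swap]
  · simp_rw [md_integral_gauss_cos c _ hc]
    rw [integral_const_mul, ← intervalIntegral.integral_of_le hu.le, mdHf, if_neg hc.ne', mdEf]
    have e3 : ∀ b : ℝ, Real.exp (-b ^ 2 / (2 * c)) = Real.exp (-(1 / 2 * (b / √c) ^ 2)) := by
      intro b
      rw [div_pow, Real.sq_sqrt hc.le]
      congr 1
      field_simp
    simp_rw [e3]
    have := sqrt_pos.2 hc
    rw [intervalIntegral.integral_comp_div (fun y => Real.exp (-(1 / 2 * y ^ 2))) this.ne', zero_div,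
      smul_eq_mul, ← mul_assoc, ← mul_assoc]
    congr 1
    rw [Real.sqrt_div (by positivity), Real.sqrt_mul (by positivity), Real.sqrt_div (by positivity)]
    have h3 : √π ^ 2 = π := Real.sq_sqrt (by positivity)
    have h4 : 0 < √π := by positivity
    field_simp
    rw [h3]
  · have hg : Integrable (fun p : ℝ × ℝ => Real.exp (-(c / 2 * p.1 ^ 2)) * (1 : ℝ))
        ((volume.restrict (Set.Ioi 0)).prod (volume.restrict (Set.Ioc 0 u))) :=
      Integrable.mul_prod (f := fun z : ℝ => Real.exp (-(c / 2 * z ^ 2))) (g := fun _ : ℝ => (1 : ℝ))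
        (md_integrable_gauss c hc) (integrable_const _)
    refine hg.mono (by fun_prop) (Filter.Eventually.of_forall fun p => ?_)
    simp only [Function.uncurry, norm_mul, Real.norm_eq_abs, abs_exp]
    rw [abs_one]
    exact mul_le_mul_of_nonneg_left (abs_cos_le_one _) (exp_pos _).le

noncomputable def mdKf (τ v w : ℝ) : ℝ := ellF (1 - v * τ) (√v * w) / (2 * v)

lemma mdKf_aux (Φ φ : ℝ → ℝ) (L : ℝ) (h0 : Filter.Tendsto Φ (nhdsWithin 0 (Set.Ioi 0)) (nhds 0))
    (h1 : Filter.Tendsto Φ (nhdsWithin 1 (Set.Iio 1)) (nhds L))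
    (hd : ∀ v ∈ Set.Ioo (0 : ℝ) 1, HasDerivAt Φ (φ v) v)
    (hn : ∀ v ∈ Set.Ioo (0 : ℝ) 1, 0 ≤ φ v) :
    IntegrableOn φ (Set.Ioo 0 1) ∧ ∫ v in Set.Ioo (0 : ℝ) 1, φ v = L := by
  have hc : ContinuousOn (extendFrom (Set.Ioo 0 1) Φ) (Set.Icc 0 1) :=
    continuousOn_Icc_extendFrom_Ioo
      (fun v hv => (hd v hv).continuousAt.continuousWithinAt) h0 h1
  have hint : IntegrableOn φ (Set.Ioc 0 1) := by
    refine intervalIntegral.integrableOn_deriv_of_nonneg hc (fun v hv => ?_) hn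
    refine (hd v hv).congr_of_eventuallyEq ?_
    filter_upwards [Ioo_mem_nhds hv.1 hv.2] with y hy
    exact extendFrom_eq (subset_closure hy) ((hd y hy).continuousAt.continuousWithinAt)
  refine ⟨hint.mono_set Set.Ioo_subset_Ioc_self, ?_⟩
  rw [← integral_Ioc_eq_integral_Ioo, ← intervalIntegral.integral_of_le zero_le_one,
    intervalIntegral.integral_eq_sub_of_hasDerivAt_of_tendsto zero_lt_one hd
      ((intervalIntegrable_iff_integrableOn_Ioc_of_le zero_le_one).2 hint) h0 h1, sub_zero]

lemma md_ellF_nonneg (t y : ℝ) : 0 ≤ ellF t y := by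
  unfold ellF
  split_ifs <;> positivity

lemma mdKf_int (τ w : ℝ) (hτ1 : τ ≤ 1) (hw : 0 < w) :
    IntegrableOn (fun v => mdKf τ v w) (Set.Ioo 0 1) ∧
      ∫ v in Set.Ioo (0 : ℝ) 1, mdKf τ v w = 1 / 2 * mdHf (1 - τ) w := by
  have hpos : ∀ v ∈ Set.Ioo (0 : ℝ) 1, 0 < 1 - v * τ := by
    intro v hv
    nlinarith [hv.1, hv.2]
  have hk : √(2 * π) = 2 * √(π / 2) := by
    rw [show 2 * π = 2 ^ 2 * (π / 2) by ring, Real.sqrt_mul (by positivity),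
      Real.sqrt_sq (by norm_num)]
  have hk2 : 1 / √(2 * π) = 1 / 2 * √(2 / π) := by
    rw [hk]
    have := md_sqrt_const
    have h3 : 0 < √(π / 2) := by positivity
    field_simp
    linarith
  refine mdKf_aux (fun v => 1 / √(2 * π) * mdEf (w * √(v / (1 - v * τ)))) _ _ ?_ ?_ ?_ ?_
  · have : ContinuousAt (fun v => 1 / √(2 * π) * mdEf (w * √(v / (1 - v * τ)))) 0 := by
      have h1 : ContinuousAt (fun v : ℝ => v / (1 - v * τ)) 0 :=
        ContinuousAt.div (by fun_prop) (by fun_prop) (by simp)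
      exact continuousAt_const.mul (mdEf_continuous.continuousAt.comp
        (continuousAt_const.mul h1.sqrt))
    have h := this.tendsto.mono_left (nhdsWithin_le_nhds (s := Set.Ioi 0))
    simpa [mdEf_zero] using h
  · rcases eq_or_lt_of_le hτ1 with h | h
    · subst h
      rw [mdHf, if_pos (by ring), mul_one]
      have e : (1 / 2 : ℝ) = 1 / √(2 * π) * √(π / 2) := by
        rw [hk]
        have h3 : 0 < √(π / 2) := by positivity
        field_simp
      rw [e]
      refine Filter.Tendsto.const_mul _ (mdEf_tendsto.comp ?_)
      refine Filter.Tendsto.const_mul_atTop hw (Real.tendsto_sqrt_atTop.comp ?_)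
      have h1 : Filter.Tendsto (fun v : ℝ => (1 - v * 1)) (nhdsWithin 1 (Set.Iio 1))
          (nhdsWithin 0 (Set.Ioi 0)) := by
        refine tendsto_nhdsWithin_iff.2 ⟨?_, ?_⟩
        · have : ContinuousAt (fun v : ℝ => 1 - v * 1) 1 := by fun_prop
          have := this.tendsto.mono_left (nhdsWithin_le_nhds (s := Set.Iio 1))
          simpa using this
        · filter_upwards [self_mem_nhdsWithin] with v hv
          simpa using hv
      have h2 : Filter.Tendsto (fun v : ℝ => v) (nhdsWithin 1 (Set.Iio 1)) (nhds 1) :=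
        Filter.tendsto_id.mono_left nhdsWithin_le_nhds
      exact h2.pos_mul_atTop one_pos (tendsto_inv_nhdsGT_zero.comp h1)
    · have hne : 1 - τ ≠ 0 := by linarith
      have : ContinuousAt (fun v => 1 / √(2 * π) * mdEf (w * √(v / (1 - v * τ)))) 1 := by
        have h1 : ContinuousAt (fun v : ℝ => v / (1 - v * τ)) 1 :=
          ContinuousAt.div (by fun_prop) (by fun_prop) (by simpa using hne)
        exact continuousAt_const.mul (mdEf_continuous.continuousAt.comp
          (continuousAt_const.mul h1.sqrt))
      have h := this.tendsto.mono_left (nhdsWithin_le_nhds (s := Set.Iio 1))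
      rw [mdHf, if_neg hne, ← mul_assoc, ← hk2]
      simpa [div_eq_mul_inv] using h
  · intro v hv
    have hp := hpos v hv
    have hv0 : 0 < v := hv.1
    have d1 : HasDerivAt (fun v : ℝ => v / (1 - v * τ)) (1 / (1 - v * τ) ^ 2) v := by
      have := (hasDerivAt_id v).div (((hasDerivAt_id v).mul_const τ).const_sub 1) hp.ne'
      refine this.congr_deriv ?_
      simp
    have d2 := (d1.sqrt (by positivity)).const_mul w
    have d3 := ((mdEf_hasDerivAt _).comp v d2).const_mul (1 / √(2 * π))
    refine d3.congr_deriv ?_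
    have sv := sqrt_pos.2 hv0
    rw [mdKf, ellF, if_pos (by positivity), mul_pow, mul_pow, Real.sq_sqrt (by positivity),
      Real.sq_sqrt hv0.le, Real.sqrt_mul (by positivity) ((1 - v * τ) ^ 3),
      show (1 - v * τ) ^ 3 = (1 - v * τ) ^ 2 * (1 - v * τ) by ring,
      Real.sqrt_mul (by positivity) (1 - v * τ), Real.sqrt_sq hp.le, Real.sqrt_div hv0.le]
    have e : -(1 / 2 * (w ^ 2 * (v / (1 - v * τ)))) = -(v * w ^ 2) / (2 * (1 - v * τ)) := by
      field_simp
    rw [e]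
    have sp := sqrt_pos.2 hp
    have q1 : √v ^ 2 = v := Real.sq_sqrt hv0.le
    have q2 : √(1 - v * τ) ^ 2 = 1 - v * τ := Real.sq_sqrt hp.le
    generalize Real.exp (-(v * w ^ 2) / (2 * (1 - v * τ))) = E
    generalize √(1 - v * τ) = B at *
    have : 0 < √(2 * π) := by positivity
    rw [← q2]
    generalize √v = A at *
    rw [← q1]
    field_simp
  · intro v hv
    exact div_nonneg (md_ellF_nonneg _ _) (by linarith [hv.1])

/-- Lebesgue measure on the positive orthant. -/
noncomputable def mdMu (m : ℕ) : Measure (Fin m → ℝ) :=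
  Measure.pi (fun _ : Fin m => (volume : Measure ℝ).restrict (Set.Ioi 0))

instance mdMu_sigmaFinite (m : ℕ) : SigmaFinite (mdMu m) := by unfold mdMu; infer_instance

lemma mdMu_eq (m : ℕ) :
    (volume : Measure (Fin m → ℝ)).restrict (Set.univ.pi fun _ => Set.Ioi (0 : ℝ)) = mdMu m := by
  rw [volume_pi, Measure.restrict_pi_pi]; rfl

lemma mdMu_ae (m : ℕ) : ∀ᵐ x ∂(mdMu m), ∀ i, 0 < x i := by
  rw [← mdMu_eq]
  filter_upwards [ae_restrict_mem (MeasurableSet.univ_pi fun _ => measurableSet_Ioi)] with x hx i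
  exact hx i (Set.mem_univ i)

noncomputable def mdG {n : ℕ} (a : Fin (n + 1) → ℝ) (c : Fin (n + 2) → ℝ) (x : Fin (n + 2) → ℝ)
    (u : Fin (n + 1) → ℝ) : ℝ :=
  x 0 ^ (-(1 : ℝ) / 2) * (∏ j, Real.exp (-(c j / 2 * x j))) *
    ∏ k, (Real.exp (-(a k * u k)) * (Real.sin (√(x k.castSucc) * u k) / (π * √(x k.castSucc))) *
      Real.sin (√(x k.succ) * u k))

noncomputable def mdX {n : ℕ} (a : Fin (n + 1) → ℝ) (c : Fin (n + 2) → ℝ)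
    (x : Fin (n + 2) → ℝ) : ℝ :=
  x 0 ^ (-(1 : ℝ) / 2) * (∏ j, Real.exp (-(c j / 2 * x j))) *
    ∏ k, transP (a k) (x (Fin.castSucc k)) (x k.succ)

/-- The common part of the excursion-side integrand. -/
noncomputable def mdB {n : ℕ} (a : Fin (n + 1) → ℝ) (c : Fin (n + 2) → ℝ)
    (u : Fin (n + 1) → ℝ) : ℝ :=
  (∏ k, Real.exp (-(a k * u k))) * ellF (c (Fin.last _)) (u (Fin.last n)) *
    ∏ m : Fin n, gF (c m.succ.castSucc) (u m.castSucc) (u m.succ)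

lemma mdG_integral_u {n : ℕ} (a : Fin (n + 1) → ℝ) (c : Fin (n + 2) → ℝ) (x : Fin (n + 2) → ℝ)
    (ha : ∀ k, 0 < a k) (hx : ∀ i, 0 < x i) :
    ∫ u, mdG a c x u ∂(mdMu (n + 1)) = mdX a c x := by
  unfold mdG mdX mdMu
  rw [integral_const_mul]
  congr 1
  rw [integral_fintype_prod_eq_prod (f := fun k u => Real.exp (-(a k * u)) *
    (Real.sin (√(x k.castSucc) * u) / (π * √(x k.castSucc))) * Real.sin (√(x k.succ) * u))]
  exact Finset.prod_congr rfl fun k _ => md_transP_eq _ _ _ (ha k) (hx _) (hx _)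

lemma mdG_integral_x {n : ℕ} (a : Fin (n + 1) → ℝ) (c : Fin (n + 2) → ℝ) (u : Fin (n + 1) → ℝ)
    (hc : ∀ k, 0 < c k) (hu : ∀ i, 0 < u i) :
    ∫ x, mdG a c x u ∂(mdMu (n + 2)) = 2 * π * (mdHf (c 0) (u 0) * mdB a c u) := by
  let α : Fin (n + 2) → ℝ → ℝ := fun j x =>
    Fin.lastCases (motive := fun _ => ℝ) 1 (fun k => Real.sin (√x * u k) / (π * √x)) j
  let β : Fin (n + 2) → ℝ → ℝ := fun j x =>
    Fin.cases (motive := fun _ => ℝ) (x ^ (-(1 : ℝ) / 2)) (fun k => Real.sin (√x * u k)) j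
  have hα1 : ∀ x, α (Fin.last (n + 1)) x = 1 := fun x => by simp [α]
  have hα2 : ∀ (k : Fin (n + 1)) x, α k.castSucc x = Real.sin (√x * u k) / (π * √x) :=
    fun k x => by simp only [α, Fin.lastCases_castSucc]
  have hβ1 : ∀ x, β 0 x = x ^ (-(1 : ℝ) / 2) := fun x => by simp only [β, Fin.cases_zero]
  have hβ2 : ∀ (k : Fin (n + 1)) x, β k.succ x = Real.sin (√x * u k) :=
    fun k x => by simp only [β, Fin.cases_succ]
  have h1 : ∀ x : Fin (n + 2) → ℝ, mdG a c x u = (∏ k, Real.exp (-(a k * u k))) *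
      ∏ j, (Real.exp (-(c j / 2 * x j)) * α j (x j) * β j (x j)) := by
    intro x
    unfold mdG
    rw [Finset.prod_mul_distrib, Finset.prod_mul_distrib, Finset.prod_mul_distrib,
      Finset.prod_mul_distrib, Fin.prod_univ_castSucc (fun j => α j (x j)),
      Fin.prod_univ_succ (fun j => β j (x j))]
    simp only [hα1, hα2, hβ1, hβ2]
    ring
  have key : ∀ J : Fin (n + 2) → ℝ, ∏ j, J j =
      J 0 * ((∏ m : Fin n, J m.castSucc.succ) * J (Fin.last n).succ) := by
    intro J
    rw [Fin.prod_univ_succ, Fin.prod_univ_castSucc]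
  simp_rw [h1]
  rw [integral_const_mul]
  unfold mdMu
  rw [integral_fintype_prod_eq_prod (f := fun j x => Real.exp (-(c j / 2 * x)) * α j x * β j x),
    key]
  have e0 : ∫ x in Set.Ioi (0 : ℝ), Real.exp (-(c 0 / 2 * x)) * α 0 x * β 0 x =
      mdHf (c 0) (u 0) := by
    rw [← mdHf_eq _ _ (hc 0) (hu 0)]
    simp only [hβ1]
    have := hα2 0
    simp only [Fin.castSucc_zero] at this
    simp only [this]
  have e1 : ∫ x in Set.Ioi (0 : ℝ), Real.exp (-(c (Fin.last n).succ / 2 * x)) *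
      α (Fin.last n).succ x * β (Fin.last n).succ x =
      2 * π * ellF (c (Fin.last (n + 1))) (u (Fin.last n)) := by
    rw [← md_ellF_eq _ _ (hc _) (hu _)]
    have hα1' : ∀ x, α (Fin.last n).succ x = 1 := hα1
    simp only [hβ2, hα1', mul_one]
    rfl
  have e2 : ∀ m : Fin n, ∫ x in Set.Ioi (0 : ℝ), Real.exp (-(c m.castSucc.succ / 2 * x)) *
      α m.castSucc.succ x * β m.castSucc.succ x =
      gF (c m.succ.castSucc) (u m.castSucc) (u m.succ) := by
    intro m
    rw [← md_gF_eq _ _ _ (hc _) (hu _) (hu _)]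
    simp only [hβ2]
    simp only [Fin.succ_castSucc, hα2]
  rw [e0, e1, Finset.prod_congr rfl fun m _ => e2 m, mdB]
  ring

lemma mdG_measurable {n : ℕ} (a : Fin (n + 1) → ℝ) (c : Fin (n + 2) → ℝ) :
    Measurable (Function.uncurry (mdG a c)) := by
  unfold mdG Function.uncurry
  fun_prop

lemma mdG_integrable {n : ℕ} (a : Fin (n + 1) → ℝ) (c : Fin (n + 2) → ℝ)
    (ha : ∀ k, 0 < a k) (hc : ∀ k, 0 < c k) :
    Integrable (Function.uncurry (mdG a c)) ((mdMu (n + 2)).prod (mdMu (n + 1))) := by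
  let B : Fin (n + 2) → ℝ → ℝ := fun j x =>
    Real.exp (-(c j / 2 * x)) * (if j = 0 then x ^ (-(1 : ℝ) / 2) else 1)
  have hB : ∀ j, IntegrableOn (B j) (Set.Ioi 0) := by
    intro j
    have hj : 0 < c j / 2 := by have := hc j; positivity
    by_cases h : j = 0
    · have := integrableOn_rpow_mul_exp_neg_mul_rpow (s := -(1 : ℝ) / 2) (p := 1) (b := c j / 2)
        (by norm_num) (by norm_num) hj
      simp only [Real.rpow_one, neg_mul] at this
      simp only [B, if_pos h]
      simpa only [mul_comm] using this
    · simp only [B, if_neg h, mul_one]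
      simpa using integrableOn_exp_mul_Ioi (a := -(c j / 2)) (by linarith) 0
  have hC : ∀ k, IntegrableOn (fun u : ℝ => u * Real.exp (-(a k * u)) / π) (Set.Ioi 0) := by
    intro k
    have := integrableOn_rpow_mul_exp_neg_mul_rpow (s := 1) (p := 1) (b := a k)
        (by norm_num) (by norm_num) (ha k)
    simp only [Real.rpow_one, neg_mul] at this
    exact this.div_const π
  have hBi : Integrable (fun x : Fin (n + 2) → ℝ => ∏ j, B j (x j)) (mdMu (n + 2)) :=
    Integrable.fintype_prod hB
  have hCi : Integrable (fun u : Fin (n + 1) → ℝ => ∏ k, (u k * Real.exp (-(a k * u k)) / π))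
      (mdMu (n + 1)) :=
    Integrable.fintype_prod (f := fun k (u : ℝ) => u * Real.exp (-(a k * u)) / π) hC
  refine (hBi.mul_prod hCi).mono (mdG_measurable a c).aestronglyMeasurable ?_
  have hx : ∀ᵐ p ∂((mdMu (n + 2)).prod (mdMu (n + 1))), ∀ i, 0 < p.1 i :=
    Measure.quasiMeasurePreserving_fst.ae (mdMu_ae _)
  have hu : ∀ᵐ p ∂((mdMu (n + 2)).prod (mdMu (n + 1))), ∀ i, 0 < p.2 i :=
    Measure.quasiMeasurePreserving_snd.ae (mdMu_ae _)
  filter_upwards [hx, hu] with p hx hu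
  obtain ⟨x, u⟩ := p
  simp only at hx hu
  have hBx : ∏ j, B j (x j) = x 0 ^ (-(1 : ℝ) / 2) * ∏ j, Real.exp (-(c j / 2 * x j)) := by
    simp only [B]
    rw [Finset.prod_mul_distrib, mul_comm]
    congr 1
    rw [Finset.prod_ite_eq' Finset.univ (0 : Fin (n + 2)) (fun j => x j ^ (-(1 : ℝ) / 2))]
    simp
  simp only [Function.uncurry]
  rw [hBx, mdG]
  refine (norm_mul _ _).trans_le (le_trans ?_ (norm_mul _ _).symm.le)
  refine mul_le_mul_of_nonneg_left ?_ (norm_nonneg _)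
  rw [norm_prod, norm_prod]
  refine Finset.prod_le_prod (fun _ _ => norm_nonneg _) fun k _ => ?_
  have hs : 0 < √(x k.castSucc) := sqrt_pos.2 (hx _)
  rw [norm_mul, norm_mul, Real.norm_eq_abs, Real.norm_eq_abs, Real.norm_eq_abs, Real.norm_eq_abs,
    abs_exp, abs_div, abs_of_pos (mul_pos pi_pos hs),
    abs_of_nonneg (div_nonneg (mul_nonneg (hu k).le (exp_pos _).le) pi_pos.le)]
  have h1 : |Real.sin (√(x k.castSucc) * u k)| / (π * √(x k.castSucc)) ≤ u k / π := by
    rw [div_le_div_iff₀ (by positivity) pi_pos]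
    have : |Real.sin (√(x k.castSucc) * u k)| ≤ √(x k.castSucc) * u k := by
      refine abs_sin_le_abs.trans (le_of_eq ?_)
      exact abs_of_pos (mul_pos hs (hu k))
    nlinarith [pi_pos]
  calc _ ≤ Real.exp (-(a k * u k)) * (u k / π) * 1 := by
        refine mul_le_mul (mul_le_mul_of_nonneg_left h1 (exp_pos _).le) (abs_sin_le_one _)
          (abs_nonneg _) ?_
        have := hu k
        positivity
    _ = _ := by ring

lemma mdX_main_pos {n : ℕ} (a : Fin (n + 1) → ℝ) (c : Fin (n + 2) → ℝ)
    (ha : ∀ k, 0 < a k) (hc : ∀ k, 0 < c k) :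
    Integrable (mdX a c) (mdMu (n + 2)) ∧ ∫ x, mdX a c x ∂(mdMu (n + 2)) =
      ∫ u, 2 * π * (mdHf (c 0) (u 0) * mdB a c u) ∂(mdMu (n + 1)) := by
  have h := integral_integral_swap (mdG_integrable a c ha hc)
  have h1 : (fun x => ∫ u, mdG a c x u ∂(mdMu (n + 1))) =ᵐ[mdMu (n + 2)] mdX a c := by
    filter_upwards [mdMu_ae (n + 2)] with x hx
    exact mdG_integral_u a c x ha hx
  have h2 : (fun u => ∫ x, mdG a c x u ∂(mdMu (n + 2))) =ᵐ[mdMu (n + 1)]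
      fun u => 2 * π * (mdHf (c 0) (u 0) * mdB a c u) := by
    filter_upwards [mdMu_ae (n + 1)] with u hu
    exact mdG_integral_x a c u hc hu
  refine ⟨(integrable_congr h1).1 (mdG_integrable a c ha hc).integral_prod_left, ?_⟩
  rw [← integral_congr_ae h1, ← integral_congr_ae h2, h]

lemma md_ellF_le (c y : ℝ) (hc : 0 < c) : ellF c y ≤ (1 + 2 * c) / √(2 * π * c ^ 3) := by
  unfold ellF
  split_ifs with h
  · gcongr
    have h1 : y ^ 2 / (2 * c) + 1 ≤ Real.exp (y ^ 2 / (2 * c)) := Real.add_one_le_exp _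
    rw [neg_div, Real.exp_neg, ← div_eq_mul_inv, div_le_iff₀ (exp_pos _)]
    have h2 : y ≤ (1 + 2 * c) * (y ^ 2 / (2 * c) + 1) := by
      have : (1 + 2 * c) * (y ^ 2 / (2 * c) + 1) = y ^ 2 / (2 * c) + 1 + y ^ 2 + 2 * c := by
        field_simp; ring
      rw [this]
      have : 0 ≤ y ^ 2 / (2 * c) := by positivity
      nlinarith [sq_nonneg (y - 1)]
    refine h2.trans ?_
    gcongr
  · positivity

lemma md_gF_nonneg (c y z : ℝ) (hc : 0 < c) : 0 ≤ gF c y z := by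
  unfold gF
  split_ifs with h
  · refine mul_nonneg (by positivity) (sub_nonneg.2 ?_)
    apply Real.exp_le_exp.2
    refine div_le_div_of_nonneg_right ?_ (by positivity)
    nlinarith [mul_pos h.1 h.2]
  · exact le_rfl

lemma md_gF_le (c y z : ℝ) (hc : 0 < c) : gF c y z ≤ 1 / √(2 * π * c) := by
  unfold gF
  split_ifs with h
  · refine mul_le_of_le_one_right (by positivity) ?_
    have h1 : Real.exp (-((y - z) ^ 2) / (2 * c)) ≤ 1 := by
      rw [Real.exp_le_one_iff, neg_div]
      have : 0 ≤ (y - z) ^ 2 / (2 * c) := by positivity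
      linarith
    linarith [exp_pos (-((y + z) ^ 2) / (2 * c))]
  · positivity

lemma md_gF_symm (c y z : ℝ) : gF c y z = gF c z y := by
  unfold gF
  rw [show (y - z) ^ 2 = (z - y) ^ 2 by ring, add_comm y z]
  simp only [and_comm]

lemma md_ellF_measurable : Measurable (fun p : ℝ × ℝ => ellF p.1 p.2) := by
  unfold ellF
  refine Measurable.ite (measurableSet_lt measurable_const measurable_snd) ?_ measurable_const
  fun_prop

lemma md_gF_measurable (c : ℝ) : Measurable (fun p : ℝ × ℝ => gF c p.1 p.2) := by
  unfold gF
  refine Measurable.ite ((measurableSet_lt measurable_const measurable_fst).inter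
    (measurableSet_lt measurable_const measurable_snd)) ?_ measurable_const
  fun_prop

lemma mdB_measurable {n : ℕ} (a : Fin (n + 1) → ℝ) (c : Fin (n + 2) → ℝ) :
    Measurable (mdB a c) := by
  unfold mdB
  refine Measurable.mul (Measurable.mul (by fun_prop) ?_) ?_
  · exact md_ellF_measurable.comp (by fun_prop :
      Measurable fun u : Fin (n + 1) → ℝ => (c (Fin.last _), u (Fin.last n)))
  · refine Finset.measurable_prod _ fun m _ => ?_
    exact (md_gF_measurable _).comp (by fun_prop :
      Measurable fun u : Fin (n + 1) → ℝ => (u m.castSucc, u m.succ))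

lemma mdB_nonneg {n : ℕ} (a : Fin (n + 1) → ℝ) (c : Fin (n + 2) → ℝ)
    (hc : ∀ k : Fin (n + 1), 0 < c k.succ) (u : Fin (n + 1) → ℝ) : 0 ≤ mdB a c u := by
  unfold mdB
  refine mul_nonneg (mul_nonneg (by positivity) (md_ellF_nonneg _ _)) ?_
  refine Finset.prod_nonneg fun m _ => md_gF_nonneg _ _ _ ?_
  rw [← Fin.succ_castSucc]
  exact hc _

lemma mdB_integrable {n : ℕ} (a : Fin (n + 1) → ℝ) (c : Fin (n + 2) → ℝ) (ha : ∀ k, 0 < a k)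
    (hc : ∀ k : Fin (n + 1), 0 < c k.succ) : Integrable (mdB a c) (mdMu (n + 1)) := by
  have hE : Integrable (fun u : Fin (n + 1) → ℝ => ∏ k, Real.exp (-(a k * u k))) (mdMu (n + 1)) := by
    refine Integrable.fintype_prod (f := fun k (u : ℝ) => Real.exp (-(a k * u))) fun k => ?_
    simpa [IntegrableOn] using integrableOn_exp_mul_Ioi (a := -(a k)) (by linarith [ha k]) 0
  have hl : 0 < c (Fin.last (n + 1)) := hc (Fin.last n)
  refine (hE.mul_const ((1 + 2 * c (Fin.last (n + 1))) / √(2 * π * c (Fin.last (n + 1)) ^ 3) *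
    ∏ m : Fin n, 1 / √(2 * π * c m.succ.castSucc))).mono
    (mdB_measurable a c).aestronglyMeasurable (Filter.Eventually.of_forall fun u => ?_)
  rw [Real.norm_of_nonneg (mdB_nonneg a c hc u), Real.norm_of_nonneg (by positivity), mdB, mul_assoc]
  have hm : ∀ m : Fin n, 0 < c m.succ.castSucc := fun m => by
    rw [← Fin.succ_castSucc]
    exact hc _
  refine mul_le_mul_of_nonneg_left ?_ (by positivity)
  refine mul_le_mul (md_ellF_le _ _ hl) ?_ (Finset.prod_nonneg fun m _ => md_gF_nonneg _ _ _ (hm m))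
    (by positivity)
  exact Finset.prod_le_prod (fun m _ => md_gF_nonneg _ _ _ (hm m)) fun m _ => md_gF_le _ _ _ (hm m)

lemma md_transP_nonneg (a x y : ℝ) (ha : 0 < a) (hx : 0 < x) (hy : 0 < y) : 0 ≤ transP a x y := by
  unfold transP
  positivity

lemma mdX_nonneg {n : ℕ} (a : Fin (n + 1) → ℝ) (c : Fin (n + 2) → ℝ) (x : Fin (n + 2) → ℝ)
    (ha : ∀ k, 0 < a k) (hx : ∀ i, 0 < x i) : 0 ≤ mdX a c x := by
  unfold mdX
  have := hx 0
  refine mul_nonneg (by positivity) (Finset.prod_nonneg fun k _ =>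
    md_transP_nonneg _ _ _ (ha k) (hx _) (hx _))

lemma mdX_measurable {n : ℕ} (a : Fin (n + 1) → ℝ) (c : Fin (n + 2) → ℝ) :
    Measurable (mdX a c) := by
  unfold mdX transP
  fun_prop

lemma mdX_update {n : ℕ} (a : Fin (n + 1) → ℝ) (c : Fin (n + 2) → ℝ) (x : Fin (n + 2) → ℝ)
    (h0 : c 0 = 0) (r : ℝ) :
    mdX a (Function.update c 0 r) x = Real.exp (-(r / 2 * x 0)) * mdX a c x := by
  unfold mdX
  rw [Fin.prod_univ_succ, Fin.prod_univ_succ (fun j => Real.exp (-(c j / 2 * x j)))]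
  simp [Function.update_of_ne, h0]
  ring

lemma mdB_update {n : ℕ} (a : Fin (n + 1) → ℝ) (c : Fin (n + 2) → ℝ) (u : Fin (n + 1) → ℝ)
    (r : ℝ) : mdB a (Function.update c 0 r) u = mdB a c u := by
  unfold mdB
  have h1 : Function.update c 0 r (Fin.last (n + 1)) = c (Fin.last (n + 1)) :=
    Function.update_of_ne (Fin.succ_ne_zero (Fin.last n)) _ _
  have h2 : ∀ m : Fin n, Function.update c 0 r m.succ.castSucc = c m.succ.castSucc := fun m => by
    rw [← Fin.succ_castSucc]
    exact Function.update_of_ne (Fin.succ_ne_zero _) _ _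
  simp only [h1, h2]

lemma mdX_main {n : ℕ} (a : Fin (n + 1) → ℝ) (c : Fin (n + 2) → ℝ)
    (ha : ∀ k, 0 < a k) (hc : ∀ k : Fin (n + 1), 0 < c k.succ) (hc0 : 0 ≤ c 0) :
    ∫ x, mdX a c x ∂(mdMu (n + 2)) =
      ∫ u, 2 * π * (mdHf (c 0) (u 0) * mdB a c u) ∂(mdMu (n + 1)) := by
  rcases hc0.eq_or_lt with h0 | h0
  swap
  · refine (mdX_main_pos a c ha fun k => ?_).2
    refine Fin.cases h0 hc k
  have h0 := h0.symm
  set r : ℕ → ℝ := fun m => 1 / ((m : ℝ) + 1) with hr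
  have hrpos : ∀ m, 0 < r m := fun m => by positivity
  have hm := fun m => mdX_main_pos a (Function.update c 0 (r m)) ha (fun k => by
    refine Fin.cases ?_ (fun k => ?_) k
    · simpa using hrpos m
    · simpa [Function.update_of_ne] using hc k)
  have hRHS : Filter.Tendsto
      (fun m => ∫ u, 2 * π * (mdHf (r m) (u 0) * mdB a c u) ∂(mdMu (n + 1))) Filter.atTop
      (nhds (∫ u, 2 * π * (mdHf (c 0) (u 0) * mdB a c u) ∂(mdMu (n + 1)))) := by
    refine tendsto_integral_of_dominated_convergence (fun u => 2 * π * mdB a c u) (fun m => ?_)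
      ((mdB_integrable a c ha hc).const_mul _) (fun m => ?_) ?_
    · exact (((((mdHf_measurable (r m)).comp (measurable_pi_apply 0)).mul
        (mdB_measurable a c)).const_mul _)).aestronglyMeasurable
    · filter_upwards [mdMu_ae (n + 1)] with u hu
      have hB := mdB_nonneg a c hc u
      have hH := mdHf_nonneg (r m) (u 0) (hu 0).le
      rw [Real.norm_of_nonneg (by positivity)]
      gcongr
      exact mul_le_of_le_one_left hB (mdHf_le _ _)
    · filter_upwards [mdMu_ae (n + 1)] with u hu
      rw [h0]
      exact ((mdHf_tendsto (u 0) (hu 0)).mul_const _).const_mul _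
  have hLHS : Filter.Tendsto
      (fun m => ∫⁻ x, ENNReal.ofReal (mdX a (Function.update c 0 (r m)) x) ∂(mdMu (n + 2)))
      Filter.atTop (nhds (∫⁻ x, ENNReal.ofReal (mdX a c x) ∂(mdMu (n + 2)))) := by
    refine lintegral_tendsto_of_tendsto_of_monotone
      (fun m => (mdX_measurable _ _).ennreal_ofReal.aemeasurable) ?_ ?_
    · filter_upwards [mdMu_ae (n + 2)] with x hx
      intro m m' hmm
      refine ENNReal.ofReal_le_ofReal ?_
      rw [mdX_update _ _ _ h0, mdX_update _ _ _ h0]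
      refine mul_le_mul_of_nonneg_right ?_ (mdX_nonneg a c x ha hx)
      have h3 : r m' ≤ r m := one_div_le_one_div_of_le (by positivity) (by gcongr)
      have := hx 0
      gcongr
    · filter_upwards [mdMu_ae (n + 2)] with x hx
      refine ENNReal.tendsto_ofReal ?_
      simp_rw [mdX_update _ _ _ h0]
      have hr0 : Filter.Tendsto r Filter.atTop (nhds 0) := tendsto_one_div_add_atTop_nhds_zero_nat
      have hcont : Continuous fun r : ℝ => Real.exp (-(r / 2 * x 0)) * mdX a c x := by fun_prop
      have := (hcont.tendsto 0).comp hr0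
      simp only [zero_div, zero_mul, neg_zero, Real.exp_zero, one_mul] at this
      exact this
  have hEq : ∀ m, ∫⁻ x, ENNReal.ofReal (mdX a (Function.update c 0 (r m)) x) ∂(mdMu (n + 2)) =
      ENNReal.ofReal (∫ u, 2 * π * (mdHf (r m) (u 0) * mdB a c u) ∂(mdMu (n + 1))) := by
    intro m
    rw [← ofReal_integral_eq_lintegral_ofReal (hm m).1, (hm m).2]
    · simp [mdB_update]
    · filter_upwards [mdMu_ae (n + 2)] with x hx
      exact mdX_nonneg _ _ x ha hx
  simp_rw [hEq] at hLHS
  have hfin := tendsto_nhds_unique hLHS (ENNReal.tendsto_ofReal hRHS)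
  rw [integral_eq_lintegral_of_nonneg_ae _ (mdX_measurable _ _).aestronglyMeasurable, hfin,
    ENNReal.toReal_ofReal]
  · refine integral_nonneg_of_ae ?_
    filter_upwards [mdMu_ae (n + 1)] with u hu
    have hB := mdB_nonneg a c hc u
    have hH := mdHf_nonneg (c 0) (u 0) (hu 0).le
    simp only [Pi.zero_apply]
    positivity
  · filter_upwards [mdMu_ae (n + 2)] with x hx
    exact mdX_nonneg _ _ x ha hx

lemma md_ellF_scale (v c w : ℝ) (hv : 0 < v) (hc : 0 < c) :
    ellF (v * c) (√v * w) = ellF c w / v := by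
  have hs := sqrt_pos.2 hv
  unfold ellF
  by_cases h : 0 < w
  · rw [if_pos h, if_pos (by positivity), mul_pow, Real.sq_sqrt hv.le,
      show 2 * π * (v * c) ^ 3 = v ^ 2 * v * (2 * π * c ^ 3) by ring,
      Real.sqrt_mul (by positivity) (2 * π * c ^ 3), Real.sqrt_mul (by positivity) v,
      Real.sqrt_sq hv.le, show -(v * w ^ 2) / (2 * (v * c)) = -(w ^ 2) / (2 * c) by field_simp]
    have : 0 < √(2 * π * c ^ 3) := by positivity
    field_simp
  · rw [if_neg h, if_neg (fun h' => h ((pos_iff_pos_of_mul_pos h').1 hs)), zero_div]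

lemma md_gF_scale (v c w z : ℝ) (hv : 0 < v) (hc : 0 < c) (hw : 0 < w) (hz : 0 < z) :
    gF (v * c) (√v * w) (√v * z) = gF c w z / √v := by
  have hs := sqrt_pos.2 hv
  unfold gF
  rw [if_pos ⟨mul_pos hs hw, mul_pos hs hz⟩, if_pos ⟨hw, hz⟩, ← mul_sub, ← mul_add, mul_pow, mul_pow,
    Real.sq_sqrt hv.le, show 2 * π * (v * c) = v * (2 * π * c) by ring, Real.sqrt_mul hv.le,
    show -(v * (w - z) ^ 2) / (2 * (v * c)) = -((w - z) ^ 2) / (2 * c) by field_simp,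
    show -(v * (w + z) ^ 2) / (2 * (v * c)) = -((w + z) ^ 2) / (2 * c) by field_simp]
  have : 0 < √(2 * π * c) := by positivity
  field_simp

open scoped Pointwise in
lemma mdMu_scale_rev (n : ℕ) (R : ℝ) (hR : 0 < R) (f : (Fin (n + 1) → ℝ) → ℝ) :
    ∫ u, f u ∂(mdMu (n + 1)) =
      R ^ (n + 1) * ∫ w, f (fun k => R * w k.rev) ∂(mdMu (n + 1)) := by
  have hmp : MeasurePreserving (MeasurableEquiv.arrowCongr' (Fin.revPerm (n := n + 1))
      (MeasurableEquiv.refl ℝ)) (mdMu (n + 1)) (mdMu (n + 1)) :=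
    measurePreserving_arrowCongr' _ _ _ _ fun _ => MeasurePreserving.id _
  have h1 := hmp.integral_comp (MeasurableEquiv.measurableEmbedding _) (fun w => f (R • w))
  have h2 : ∫ w, f (fun k => R * w k.rev) ∂(mdMu (n + 1)) = ∫ w, f (R • w) ∂(mdMu (n + 1)) := by
    rw [← h1]
    rfl
  rw [h2, ← mdMu_eq, Measure.setIntegral_comp_smul_of_pos volume f _ hR]
  have h3 : R • (Set.univ.pi fun _ : Fin (n + 1) => Set.Ioi (0 : ℝ)) =
      Set.univ.pi fun _ : Fin (n + 1) => Set.Ioi (0 : ℝ) := by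
    ext x
    rw [Set.mem_smul_set_iff_inv_smul_mem₀ hR.ne']
    simp only [Set.mem_univ_pi, Set.mem_Ioi, Pi.smul_apply, smul_eq_mul]
    refine forall_congr' fun i => ?_
    rw [mul_pos_iff_of_pos_left (inv_pos.2 hR)]
  rw [h3]
  simp only [Module.finrank_fintype_fun_eq_card, Fintype.card_fin, smul_eq_mul]
  rw [mul_inv_cancel_left₀ (by positivity)]

lemma md_lhs_inner (n : ℕ) (s : Fin (n + 2) → ℝ) (t : Fin (n + 3) → ℝ)
    (htlast : t (Fin.last (n + 2)) = 1)
    (hc : ∀ k : Fin (n + 1), 0 < t k.succ.succ - t k.succ.castSucc)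
    (v : ℝ) (hv : 0 < v) :
    (∫ u : Fin (n + 1) → ℝ in Set.univ.pi fun _ => Set.Ioi (0 : ℝ),
          Real.exp (-(∑ k : Fin (n + 1),
              ((s k.rev.succ - s k.rev.castSucc) / Real.sqrt v) * u k)) *
            excDensity n (fun i => v * (1 - t i.rev.succ.castSucc)) u) *
          (1 / (2 * Real.sqrt v)) =
    ∫ w, √(8 * π) * (mdB (fun k => s k.succ - s k.castSucc) (fun j => t j.succ - t j.castSucc) w *
      mdKf (1 - t 1) v (w 0)) ∂(mdMu (n + 1)) := by
  have hs := sqrt_pos.2 hv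
  rw [mdMu_eq, mdMu_scale_rev n (√v) hs, mul_comm (√v ^ (n + 1)), mul_assoc, mul_comm,
    ← integral_const_mul]
  refine integral_congr_ae ?_
  filter_upwards [mdMu_ae (n + 1)] with w hw
  unfold excDensity
  have hE : Real.exp (-(∑ k : Fin (n + 1), ((s k.rev.succ - s k.rev.castSucc) / √v) *
      (√v * w k.rev))) = ∏ k : Fin (n + 1), Real.exp (-((s k.succ - s k.castSucc) * w k)) := by
    rw [← Real.exp_sum, Finset.sum_neg_distrib]
    congr 2
    rw [← Equiv.sum_comp Fin.revPerm (fun k => (s k.succ - s k.castSucc) * w k)]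
    refine Finset.sum_congr rfl fun k _ => ?_
    simp only [Fin.revPerm_apply]
    field_simp
  have hg : ∏ k : Fin n, gF (v * (1 - t k.succ.rev.succ.castSucc) -
      v * (1 - t k.castSucc.rev.succ.castSucc)) (√v * w k.castSucc.rev) (√v * w k.succ.rev) =
      (∏ m : Fin n, gF (t m.succ.castSucc.succ - t m.succ.castSucc.castSucc)
        (w m.castSucc) (w m.succ)) / √v ^ n := by
    rw [← Equiv.prod_comp Fin.revPerm (fun m => gF (t m.succ.castSucc.succ -
      t m.succ.castSucc.castSucc) (w m.castSucc) (w m.succ))]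
    rw [show √v ^ n = ∏ _k : Fin n, √v by simp, ← Finset.prod_div_distrib]
    refine Finset.prod_congr rfl fun k _ => ?_
    simp only [Fin.revPerm_apply]
    rw [Fin.rev_succ, Fin.rev_castSucc]
    set m := k.rev
    have hcm : 0 < t m.castSucc.succ.succ - t m.castSucc.succ.castSucc := hc m.castSucc
    rw [show v * (1 - t m.castSucc.succ.castSucc) - v * (1 - t m.succ.succ.castSucc) =
      v * (t m.castSucc.succ.succ - t m.castSucc.succ.castSucc) by
        simp only [Fin.succ_castSucc]; ring,
      md_gF_scale _ _ _ _ hv hcm (hw _) (hw _), md_gF_symm]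
    simp only [Fin.succ_castSucc]
  have hl1 : ellF (v * (1 - t (Fin.rev (0 : Fin (n + 1))).succ.castSucc))
      (√v * w (Fin.rev (0 : Fin (n + 1)))) =
      ellF (t (Fin.last (n + 1)).succ - t (Fin.last (n + 1)).castSucc) (w (Fin.last n)) / v := by
    have h0 := hc (Fin.last n)
    have e1 : t (Fin.last (n + 1)).succ = 1 := htlast
    have e2 : t (Fin.last n).succ.succ = 1 := htlast
    rw [Fin.rev_zero, e1]
    rw [e2] at h0
    exact md_ellF_scale _ _ _ hv h0
  have hl2 : ellF (1 - v * (1 - t (Fin.rev (Fin.last n)).succ.castSucc))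
      (√v * w (Fin.rev (Fin.last n))) = mdKf (1 - t 1) v (w 0) * (2 * v) := by
    rw [Fin.rev_last, mdKf, div_mul_cancel₀ _ (by positivity)]
    rfl
  rw [hE, hg, hl1, hl2, mdB]
  field_simp
  ring

lemma mdKf_measurable (τ : ℝ) : Measurable (fun p : ℝ × ℝ => mdKf τ p.1 p.2) := by
  unfold mdKf
  refine Measurable.div (md_ellF_measurable.comp (by fun_prop :
    Measurable fun p : ℝ × ℝ => (1 - p.1 * τ, √p.1 * p.2))) (by fun_prop)

lemma mdKf_nonneg (τ v w : ℝ) (hv : 0 < v) : 0 ≤ mdKf τ v w :=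
  div_nonneg (md_ellF_nonneg _ _) (by positivity)

lemma md_lhs_swap {n : ℕ} (a : Fin (n + 1) → ℝ) (c : Fin (n + 2) → ℝ)
    (ha : ∀ k, 0 < a k) (hc : ∀ k : Fin (n + 1), 0 < c k.succ) (τ : ℝ) (hτ : τ ≤ 1) :
    ∫ v in Set.Ioo (0 : ℝ) 1, ∫ w, √(8 * π) * (mdB a c w * mdKf τ v (w 0)) ∂(mdMu (n + 1)) =
    ∫ w, √(8 * π) * (mdB a c w * (1 / 2 * mdHf (1 - τ) (w 0))) ∂(mdMu (n + 1)) := by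
  have hmeas : Measurable (fun p : ℝ × (Fin (n + 1) → ℝ) =>
      √(8 * π) * (mdB a c p.2 * mdKf τ p.1 (p.2 0))) := by
    refine Measurable.const_mul (Measurable.mul ((mdB_measurable a c).comp measurable_snd) ?_) _
    exact (mdKf_measurable τ).comp (by fun_prop :
      Measurable fun p : ℝ × (Fin (n + 1) → ℝ) => (p.1, p.2 0))
  rw [integral_integral_swap]
  · refine integral_congr_ae ?_
    filter_upwards [mdMu_ae (n + 1)] with w hw
    rw [integral_const_mul, integral_const_mul, (mdKf_int τ (w 0) hτ (hw 0)).2]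
  · refine (integrable_prod_iff' (f := fun p : ℝ × (Fin (n + 1) → ℝ) =>
      √(8 * π) * (mdB a c p.2 * mdKf τ p.1 (p.2 0))) hmeas.aestronglyMeasurable).2 ⟨?_, ?_⟩
    · filter_upwards [mdMu_ae (n + 1)] with w hw
      exact ((mdKf_int τ (w 0) hτ (hw 0)).1.const_mul _).const_mul _
    · have h1 : (fun w => ∫ v in Set.Ioo (0 : ℝ) 1, ‖√(8 * π) * (mdB a c w * mdKf τ v (w 0))‖)
          =ᵐ[mdMu (n + 1)] fun w => √(8 * π) * (mdB a c w * (1 / 2 * mdHf (1 - τ) (w 0))) := by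
        filter_upwards [mdMu_ae (n + 1)] with w hw
        rw [← (mdKf_int τ (w 0) hτ (hw 0)).2, ← integral_const_mul, ← integral_const_mul]
        refine setIntegral_congr_fun measurableSet_Ioo fun v hv => ?_
        have := mdB_nonneg a c hc w
        have := mdKf_nonneg τ v (w 0) hv.1
        exact Real.norm_of_nonneg (by positivity)
      refine (integrable_congr h1).2 (Integrable.const_mul ?_ _)
      refine (mdB_integrable a c ha hc).mono ?_ ?_
      · exact ((mdB_measurable a c).mul (((mdHf_measurable _).comp
          (measurable_pi_apply 0)).const_mul _)).aestronglyMeasurable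
      · filter_upwards [mdMu_ae (n + 1)] with w hw
        rw [norm_mul]
        refine mul_le_of_le_one_right (norm_nonneg _) ?_
        have h2 := mdHf_nonneg (1 - τ) (w 0) (hw 0).le
        have h3 := mdHf_le (1 - τ) (w 0)
        rw [Real.norm_of_nonneg (by positivity)]
        linarith

/-- **Dual representation of the Brownian meander.**
The Brownian meander is `B^{me}_t = V^{−1/2} B^{ex}_{Vt}` with `V` of density `(2√v)⁻¹`
on `(0,1)` (i.e. `Beta(1/2,1)`), independent of the Brownian excursion. Here
`d = n + 1 ≥ 1`, `s₀ = 0 < s₁ < … < s_d`, `t₀ = 0 ≤ t₁ < … < t_d < 1 = t_{d+1}`. -/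
theorem meander_dual (n : ℕ) (s : Fin (n + 2) → ℝ) (t : Fin (n + 3) → ℝ)
    (hs0 : s 0 = 0) (hs : StrictMono s)
    (ht0 : t 0 = 0) (htlast : t (Fin.last (n + 2)) = 1)
    (ht1 : 0 ≤ t 1)
    (htmono : StrictMonoOn t (Set.Icc (1 : Fin (n + 3)) ⟨n + 1, by omega⟩))
    (htd : t ⟨n + 1, by omega⟩ < 1) :
    (∫ v in Set.Ioo (0 : ℝ) 1,
        (∫ u : Fin (n + 1) → ℝ in Set.univ.pi fun _ => Set.Ioi (0 : ℝ),
          Real.exp (-(∑ k : Fin (n + 1),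
              ((s k.rev.succ - s k.rev.castSucc) / Real.sqrt v) * u k)) *
            excDensity n (fun i => v * (1 - t i.rev.succ.castSucc)) u) *
          (1 / (2 * Real.sqrt v))) =
      (1 / Real.sqrt (2 * Real.pi)) *
        ∫ x : Fin (n + 2) → ℝ in Set.univ.pi fun _ => Set.Ioi (0 : ℝ),
          x 0 ^ (-(1 : ℝ) / 2) *
            Real.exp (-(1 / 2 : ℝ) * ∑ k : Fin (n + 2), (t k.succ - t k.castSucc) * x k) *
            ∏ k : Fin (n + 1), transP (s k.succ - s k.castSucc) (x k.castSucc) (x k.succ) := by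
  set a : Fin (n + 1) → ℝ := fun k => s k.succ - s k.castSucc with ha_def
  set c : Fin (n + 2) → ℝ := fun j => t j.succ - t j.castSucc with hc_def
  have ha : ∀ k, 0 < a k := fun k => sub_pos.2 (hs Fin.castSucc_lt_succ)
  have hc : ∀ k : Fin (n + 1), 0 < c k.succ := by
    intro k
    simp only [hc_def]
    refine sub_pos.2 ?_
    rcases Fin.eq_castSucc_or_eq_last k with ⟨m, rfl⟩ | rfl
    · refine htmono ⟨?_, ?_⟩ ⟨?_, ?_⟩ ?_ <;>
      simp only [Fin.le_def, Fin.lt_def, Fin.val_succ, Fin.val_castSucc, Fin.val_one] <;> omega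
    · have e1 : t (Fin.last n).succ.succ = 1 := htlast
      rw [e1]
      exact htd
  have hc0 : c 0 = t 1 := by
    simp only [hc_def]
    have : t (0 : Fin (n + 2)).castSucc = 0 := ht0
    rw [this, sub_zero]
    rfl
  have hτ : 1 - t 1 ≤ 1 := by linarith
  rw [setIntegral_congr_fun measurableSet_Ioo
    (fun v hv => md_lhs_inner n s t htlast hc v hv.1), md_lhs_swap a c ha hc _ hτ]
  have hR : ∀ x : Fin (n + 2) → ℝ, x 0 ^ (-(1 : ℝ) / 2) *
      Real.exp (-(1 / 2 : ℝ) * ∑ k : Fin (n + 2), (t k.succ - t k.castSucc) * x k) *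
      ∏ k : Fin (n + 1), transP (s k.succ - s k.castSucc) (x k.castSucc) (x k.succ) =
      mdX a c x := by
    intro x
    unfold mdX
    rw [← Real.exp_sum, Finset.mul_sum]
    congr 3
    refine Finset.sum_congr rfl fun k _ => ?_
    simp only [hc_def]
    ring
  simp_rw [hR]
  rw [mdMu_eq, mdX_main a c ha hc (by rw [hc0]; exact ht1), ← integral_const_mul]
  congr 1
  ext w
  rw [hc0, show 1 - (1 - t 1) = t 1 by ring, show 8 * π = 2 ^ 2 * (2 * π) by ring,
    Real.sqrt_mul (by positivity), Real.sqrt_sq (by norm_num)]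
  have h3 : √(2 * π) ^ 2 = 2 * π := Real.sq_sqrt (by positivity)
  have h2 : 0 < √(2 * π) := by positivity
  field_simp
  rw [h3]
end
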